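/- Let W be a tetrahedral erasure channel that is either of the form ((1−ε)², (1−ε)ε, 0, ε(1−ε), ε²) for some 0 < ε < 1 (a pair of binary erasure channels), or has all five entries strictly positive. Then there exists a constant C > 0 such that for every integer n ≥ 1, the number of strings c ∈ {s,p}^n whose descendant satisfies H(W^c) < exp(−exp(n^{1/3})) is greater than 2^n·(1 − H(W) − C·2^{−n/3.451}); that is, the 2×2 kernel [[1,0],[ω,1]] over F₄ induces a scaling exponent less than 3.451. -/

import Mathlib

noncomputable section

/-- A quintuple of reals representing a candidate tetrahedral erasure channel
`W = (p, q, r, s, t)`. -/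
structure TECQuint where
  p : ℝ
  q : ℝ
  r : ℝ
  s : ℝ
  t : ℝ

namespace TECQuint

/-- `W` is a tetrahedral erasure channel: all five entries are nonnegative and sum to 1. -/
def IsTEC (W : TECQuint) : Prop :=
  0 ≤ W.p ∧ 0 ≤ W.q ∧ 0 ≤ W.r ∧ 0 ≤ W.s ∧ 0 ≤ W.t ∧
    W.p + W.q + W.r + W.s + W.t = 1

/-- `W` is balanced: `q = r = s`. -/
def Balanced (W : TECQuint) : Prop := W.q = W.r ∧ W.r = W.s

/-- The serial child `W^s`. -/
def ser (W : TECQuint) : TECQuint where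
  p := W.p ^ 2
  q := W.p * W.s + W.s * W.q + W.q * W.p
  r := W.p * W.q + W.q * W.r + W.r * W.p
  s := W.p * W.r + W.r * W.s + W.s * W.p
  t := 1 - (W.p ^ 2 + (W.p * W.s + W.s * W.q + W.q * W.p)
      + (W.p * W.q + W.q * W.r + W.r * W.p)
      + (W.p * W.r + W.r * W.s + W.s * W.p))

/-- The parallel child `W^p`. -/
def par (W : TECQuint) : TECQuint where
  p := 1 - ((W.t * W.s + W.s * W.q + W.q * W.t)
      + (W.t * W.q + W.q * W.r + W.r * W.t)
      + (W.t * W.r + W.r * W.s + W.s * W.t) + W.t ^ 2)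
  q := W.t * W.s + W.s * W.q + W.q * W.t
  r := W.t * W.q + W.q * W.r + W.r * W.t
  s := W.t * W.r + W.r * W.s + W.s * W.t
  t := W.t ^ 2

/-- The moment of inertia `A(W) = (q−r)² + (r−s)² + (s−q)²`. -/
def inertia (W : TECQuint) : ℝ :=
  (W.q - W.r) ^ 2 + (W.r - W.s) ^ 2 + (W.s - W.q) ^ 2

/-- The (conditional) entropy `H(W) = (q+r+s)/2 + t`. -/
def entropy (W : TECQuint) : ℝ := (W.q + W.r + W.s) / 2 + W.t

/-- The edge mass `E(W) = q + r + s`. -/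
def edgeMass (W : TECQuint) : ℝ := W.q + W.r + W.s

/-- The Quetelet index `Q(W) = E(W) / (H(W)(1−H(W)))`. -/
def quetelet (W : TECQuint) : ℝ :=
  edgeMass W / (entropy W * (1 - entropy W))

/-- One step of the channel process: `true` picks the serial child, `false` the parallel child. -/
def child (W : TECQuint) (b : Bool) : TECQuint := if b then ser W else par W

/-- The descendant `W^c` of `W` along the string `c ∈ {s,p}^n`. -/
def descend : TECQuint → {n : ℕ} → (Fin n → Bool) → TECQuint
  | W, 0, _ => W
  | W, _ + 1, c => descend (child W (c 0)) (fun i => c i.succ)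

end TECQuint

open TECQuint

/-- Affine majorants `(A, B)`, meaning `A + B x`. -/
def certLines : List (ℤ × ℤ) :=
  [(9917338, 3298277790215), (9917339, 3298266447872), (9917340, 3298264948233),
   (9917339, 3298267376714), (10268264, 2768305088160), (11359901, 1762179218983),
   (11359904, 1762177521224), (12718625, 1257711486078), (13074271, 1170961959702),
   (14472418, 942147970553), (15005009, 882504027781), (16965226, 729519088824),
   (17502690, 699782540319), (20698790, 572386870844), (20698786, 572386981274),
   (25894479, 460026017985), (25894481, 460025988283), (30128795, 407611843417),
   (34526337, 365671005999), (34526338, 365670999567), (41772679, 323259199758),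
   (46960933, 299100843504), (46960929, 299100858558), (58353769, 264560739561),
   (65521555, 246792822631), (69359078, 238950626794), (69972123, 237909708362),
   (87463669, 213047967488), (97938400, 200495938683), (104319417, 194005507884),
   (105492875, 192985803738), (132991563, 172444649941), (132991570, 172444645245),
   (153616144, 160859936508), (162938093, 156282031247), (162938093, 156282031030),
   (209045289, 138707956020), (209045284, 138707957668), (211664377, 137918349569),
   (243632387, 129290153113), (260786992, 125127852361), (260786992, 125127852526),
   (296276623, 118086278878), (333752521, 111324687698), (333752515, 111324688739),
   (339202836, 110503021305), (381111893, 104699249878), (411972314, 100761174868),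
   (411972325, 100761173555), (411972324, 100761173661), (480453658, 93803251494),
   (480453671, 93803250336), (540688500, 88510018130), (540688483, 88510019533),
   (553468430, 87538686212), (605910950, 83831830441), (655986388, 80540057664),
   (670016650, 79682321418), (670016631, 79682322513), (762202409, 74807959612),
   (762202406, 74807959753), (860266817, 70323282124), (860266799, 70323282866),
   (899439313, 68773869938), (964169613, 66392777263), (1043574033, 63676361110),
   (1096871130, 61980703629), (1101162701, 61853724075), (1235894568, 58146312530),
   (1235894553, 58146312921), (1368685924, 54985955278), (1413431506, 53995580708),
   (1483989045, 52543215967), (1593461678, 50447556149), (1697304665, 48598818271),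
   (1797345612, 46942442337), (1840198256, 46282597703), (2050377478, 43272803545),
   (2055463177, 43205073625), (2263220902, 40631894061), (2364813529, 39461699548),
   (2494807684, 38069175722), (2706923050, 35956008379), (2820996871, 34899116170),
   (3054658852, 32885782719), (3146938180, 32146322137), (3491584700, 29577893807),
   (3553050283, 29151894872), (3865488321, 27138062340), (4152175749, 25419556363),
   (4325903808, 24451065975), (4797249652, 22007365472), (4965165306, 21197743232),
   (5405251098, 19222492831), (5562346691, 18562981529), (6197284310, 16059284308),
   (6287670424, 15723276449), (6745298672, 14114175726), (7094678411, 12948799681),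
   (7487368840, 11702954414), (7827541173, 10673999993), (8259075073, 9426792194),
   (8649164017, 8347409396), (9053568926, 7274147961), (9159269297, 7004641661),
   (9773739217, 5497109965), (10186568432, 4521154375), (10693072224, 3365808135),
   (11345120003, 1928946569), (11345120003, 1928946569), (12268781108, 22918701),
   (12280240458, 0)]

/-- Nodes of the certificate: abscissa, value, cell type, and three indices. -/
def certRows : List (ℤ × ℤ × ℕ × ℕ × ℕ × ℕ) :=
  [(64, 10113930, 0, 45, 2, 5), (135, 10332025, 0, 44, 2, 5), (243, 10663774, 0, 42, 3, 5),
   (422, 11213617, 0, 41, 4, 6), (711, 12101353, 0, 39, 6, 6), (1165, 13271849, 0, 38, 7, 6),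
   (1858, 14409171, 0, 37, 8, 9), (2892, 16106126, 0, 35, 9, 10),
   (4402, 17874842, 0, 34, 10, 11), (6561, 20229325, 0, 33, 11, 12),
   (9588, 22885347, 0, 32, 12, 13), (13758, 26312653, 0, 31, 13, 13),
   (19407, 30150683, 0, 30, 14, 15), (26938, 35058811, 0, 29, 15, 16),
   (36832, 40333073, 0, 28, 16, 17), (49651, 47166586, 0, 27, 18, 19),
   (66042, 54189025, 0, 27, 19, 19), (86743, 63058008, 0, 26, 20, 20),
   (112583, 72867340, 0, 25, 21, 21), (144484, 83731470, 0, 25, 22, 23),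
   (183456, 97003683, 0, 24, 23, 24), (230597, 111195886, 1, 0, 24, 25),
   (287084, 126930869, 1, 0, 26, 26), (354167, 145617468, 1, 0, 27, 27),
   (433160, 165080663, 1, 1, 28, 29), (525428, 186287884, 1, 2, 29, 30),
   (632376, 210088104, 1, 2, 30, 30), (755434, 237354149, 1, 3, 31, 32),
   (896043, 265253278, 1, 4, 33, 33), (1055641, 295054437, 1, 4, 34, 33),
   (1235643, 327577506, 1, 5, 35, 36), (1437431, 363845274, 1, 6, 36, 36),
   (1662333, 399964894, 1, 6, 38, 38), (1911612, 439999498, 1, 7, 39, 39),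
   (2186451, 481173813, 1, 7, 40, 41), (2487939, 525055085, 1, 8, 41, 42),
   (2817060, 572958312, 1, 9, 43, 43), (3174683, 619156713, 1, 9, 44, 44),
   (3561552, 669133167, 1, 10, 45, 46), (3978281, 722660537, 1, 11, 46, 46),
   (4425345, 776491888, 1, 11, 48, 49), (4903079, 832164330, 1, 12, 49, 49),
   (5411674, 891433140, 1, 12, 50, 51), (5951179, 950765967, 1, 13, 52, 51),
   (6521497, 1009896078, 1, 14, 53, 53), (7122393, 1072196492, 1, 14, 54, 54),
   (7753494, 1137145594, 1, 15, 55, 55), (8414295, 1201579490, 1, 15, 56, 56),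
   (9104164, 1266317595, 1, 16, 57, 56), (9822351, 1333713093, 1, 16, 58, 59),
   (10567993, 1403685000, 1, 17, 59, 60), (11363433, 1473175502, 1, 17, 60, 60),
   (12218745, 1547896486, 1, 18, 61, 61), (13138435, 1623707800, 1, 19, 62, 63),
   (14127349, 1705225345, 1, 19, 63, 63), (15190698, 1791916738, 1, 20, 64, 64),
   (16334084, 1881186001, 1, 21, 65, 66), (17563531, 1973405313, 1, 21, 66, 66),
   (18885517, 2071509821, 1, 22, 67, 67), (20307008, 2176998591, 1, 23, 68, 68),
   (21835493, 2283488663, 1, 23, 69, 69), (23479025, 2397994099, 1, 24, 70, 71),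
   (25246263, 2513736984, 1, 25, 71, 71), (27146519, 2638191706, 1, 26, 72, 72),
   (29189805, 2769065518, 1, 26, 73, 74), (31386887, 2904917892, 1, 27, 74, 74),
   (33749341, 3045019051, 1, 28, 75, 75), (36289614, 3191653842, 1, 29, 76, 76),
   (39021090, 3349002619, 1, 30, 77, 77), (41958161, 3508053747, 1, 31, 78, 78),
   (45116302, 3679076474, 1, 32, 79, 79), (48512153, 3852976854, 1, 33, 80, 80),
   (52163605, 4036598528, 1, 34, 81, 81), (56089898, 4228730432, 1, 35, 82, 82),
   (60311718, 4427083981, 1, 37, 83, 83), (64851310, 4632551256, 1, 38, 84, 84),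
   (69732591, 4845953814, 1, 39, 85, 85), (74981281, 5072193495, 1, 41, 86, 86),
   (80625033, 5299641999, 1, 42, 87, 87), (86693584, 5543827507, 1, 44, 88, 88),
   (93218907, 5790754866, 1, 45, 89, 89), (100235384, 6048621423, 1, 47, 90, 90),
   (107779983, 6316112787, 1, 49, 91, 92), (115892455, 6587772235, 1, 51, 92, 93),
   (124615543, 6871292961, 1, 53, 93, 94), (133995207, 7158566480, 1, 55, 94, 96),
   (144080868, 7460517005, 1, 57, 95, 97), (154925664, 7759253831, 1, 59, 96, 99),
   (166586736, 8075849811, 1, 61, 97, 99), (179125523, 8392758751, 1, 63, 99, 99),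
   (192608089, 8711942412, 1, 66, 100, 100), (207105472, 9042074349, 1, 68, 102, 100),
   (222694056, 9361577285, 1, 70, 103, 100), (239229680, 9688022529, 1, 72, 105, 101),
   (255765304, 9984048917, 1, 73, 106, 101), (272300928, 10269918831, 1, 75, 108, 101),
   (288836552, 10517231808, 1, 77, 109, 101), (305372176, 10759370264, 2, 78, 110, 102),
   (321907800, 10976728569, 2, 80, 109, 102), (338443424, 11176140083, 2, 81, 107, 102),
   (354979048, 11356365580, 2, 82, 106, 103), (371514672, 11520745179, 2, 84, 105, 103),
   (388050296, 11665917778, 2, 85, 103, 103), (404585920, 11794467882, 2, 86, 102, 103),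
   (421121544, 11906489760, 2, 87, 101, 103), (437657168, 12014361241, 2, 88, 100, 104),
   (454192792, 12099016734, 2, 89, 99, 104), (470728416, 12168642511, 2, 90, 97, 104),
   (487264040, 12220475956, 2, 91, 96, 105), (503799664, 12250181733, 2, 92, 95, 105),
   (520335288, 12279887510, 2, 93, 94, 105), (536870912, 12280240458, 0, 0, 0, 0)]


/-- The scale of the abscissae. -/
abbrev cS : ℤ := 1073741824

/-- The tail constant. -/
abbrev cK : ℤ := 238016112

def lineAt (i : ℕ) : ℤ × ℤ := certLines.getD i (12280240458, 0)

def nodeOK (X V : ℤ) : Bool :=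
  certLines.all (fun l => decide (V * cS ≤ l.1 * cS + l.2 * X))

def linesOK : Bool :=
  certLines.all (fun l => decide (0 ≤ l.2) && decide (cK ≤ 24 * l.1))

def midAt (X V Ap Bp C D : ℤ) : Bool :=
  decide (250 * ((Ap + C) * (80 * cS ^ 4) + Bp * (X ^ 2 * (80 * cS ^ 2 - 11 * (cS - X) ^ 2))
    + D * (2 * X * (80 * cS ^ 3) - X ^ 2 * (80 * cS ^ 2 - 11 * (cS - X) ^ 2)))
      ≤ 409 * V * (80 * cS ^ 4))

def tailAt (X V : ℤ) (j : ℕ) (A B : ℤ) : Bool :=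
  decide (250 * (cK * cS + j * (A * cS + 2 * B * X)) ≤ 409 * j * cS * V)

def dblAt (X V A B : ℤ) : Bool :=
  decide (100 * (A * cS + 2 * B * X) ≤ 162 * cS * V)

def cellOK (a b : ℤ × ℤ × ℕ × ℕ × ℕ × ℕ) : Bool :=
  nodeOK a.1 a.2.1 && nodeOK b.1 b.2.1 && decide (0 ≤ a.1) && decide (a.1 < b.1) &&
  decide (2 * b.1 ≤ cS) &&
  (dblAt a.1 a.2.1 (lineAt a.2.2.2.2.2).1 (lineAt a.2.2.2.2.2).2 &&
    dblAt b.1 b.2.1 (lineAt a.2.2.2.2.2).1 (lineAt a.2.2.2.2.2).2) &&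
  (if a.2.2.1 = 0 then
    decide (24 ≤ a.2.2.2.1) && decide (2 ^ a.2.2.2.1 * b.1 ^ 2 ≤ cS ^ 2) &&
    tailAt a.1 a.2.1 a.2.2.2.1 (lineAt a.2.2.2.2.1).1 (lineAt a.2.2.2.2.1).2 &&
    tailAt b.1 b.2.1 a.2.2.2.1 (lineAt a.2.2.2.2.1).1 (lineAt a.2.2.2.2.1).2
   else if a.2.2.1 = 1 then
    decide ((lineAt a.2.2.2.2.1).2 ≤ (lineAt a.2.2.2.1).2) &&
    midAt a.1 a.2.1 (lineAt a.2.2.2.1).1 (lineAt a.2.2.2.1).2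
      (lineAt a.2.2.2.2.1).1 (lineAt a.2.2.2.2.1).2 &&
    midAt b.1 b.2.1 (lineAt a.2.2.2.1).1 (lineAt a.2.2.2.1).2
      (lineAt a.2.2.2.2.1).1 (lineAt a.2.2.2.2.1).2
   else
    midAt a.1 a.2.1 (lineAt a.2.2.2.1).1 (lineAt a.2.2.2.1).2
      ((lineAt a.2.2.2.2.1).1 + (lineAt a.2.2.2.2.1).2) (-(lineAt a.2.2.2.2.1).2) &&
    midAt b.1 b.2.1 (lineAt a.2.2.2.1).1 (lineAt a.2.2.2.1).2
      ((lineAt a.2.2.2.2.1).1 + (lineAt a.2.2.2.2.1).2) (-(lineAt a.2.2.2.2.1).2))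

def walkOK : List (ℤ × ℤ × ℕ × ℕ × ℕ × ℕ) → Bool
  | [] => true
  | [b] => decide (2 * b.1 = cS)
  | a :: b :: l => cellOK a b && walkOK (b :: l)

set_option maxRecDepth 100000 in
theorem linesOK_true : linesOK = true := by decide +kernel

set_option maxRecDepth 100000 in
theorem walkOK_true : walkOK certRows = true := by decide +kernel

/-- The value of an affine function. -/
def lv (l : ℤ × ℤ) (x : ℝ) : ℝ := (l.1 : ℝ) + (l.2 : ℝ) * x

def minLine (L : List (ℤ × ℤ)) (x : ℝ) : ℝ :=
  L.foldr (fun l acc => min (lv l x) acc) (12280240458 : ℝ)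

theorem minLine_le (L : List (ℤ × ℤ)) (x : ℝ) : ∀ l ∈ L, minLine L x ≤ lv l x := by
  induction L with
  | nil => simp
  | cons a L ih =>
    intro l hl
    rcases List.mem_cons.1 hl with rfl | h
    · exact min_le_left _ _
    · exact (min_le_right _ _).trans (ih l h)

theorem minLine_le_top (L : List (ℤ × ℤ)) (x : ℝ) : minLine L x ≤ 12280240458 := by
  induction L with
  | nil => simp [minLine]
  | cons a L ih => exact (min_le_right _ _).trans ih

theorem le_minLine (L : List (ℤ × ℤ)) (x c : ℝ) (h0 : c ≤ 12280240458)
    (h : ∀ l ∈ L, c ≤ lv l x) : c ≤ minLine L x := by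
  induction L with
  | nil => simpa [minLine] using h0
  | cons a L ih =>
    exact le_min (h a (by simp)) (ih fun l hl => h l (by simp [hl]))

theorem lines_prop (l : ℤ × ℤ) (hl : l ∈ certLines) :
    (0 : ℝ) ≤ (l.2 : ℝ) ∧ (238016112 : ℝ) ≤ 24 * (l.1 : ℝ) := by
  have h := linesOK_true
  simp only [linesOK, List.all_eq_true, Bool.and_eq_true, decide_eq_true_eq, cK] at h
  have := h l hl
  exact ⟨by exact_mod_cast this.1, by exact_mod_cast this.2⟩

theorem top_mem : ((12280240458 : ℤ), (0 : ℤ)) ∈ certLines := by decide +kernel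

theorem lineAt_mem (i : ℕ) : lineAt i ∈ certLines := by
  unfold lineAt
  by_cases h : i < certLines.length
  · rw [List.getD_eq_getElem _ _ h]; exact List.getElem_mem h
  · rw [List.getD_eq_default _ _ (not_lt.1 h)]; exact top_mem

/-- Binary logarithm of the inverse. -/
def Lb (x : ℝ) : ℝ := -Real.logb 2 x

theorem Lb_anti {x y : ℝ} (hx : 0 < x) (hxy : x ≤ y) : Lb y ≤ Lb x := by
  unfold Lb
  have := Real.logb_le_logb_of_le (b := 2) (by norm_num) hx hxy
  linarith

theorem Lb_pow (j : ℕ) : Lb ((1 / 2 : ℝ) ^ j) = j := by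
  unfold Lb
  rw [Real.logb_pow]
  have : Real.logb 2 (1 / 2 : ℝ) = -1 := by
    rw [one_div, Real.logb_inv, Real.logb_self_eq_one (by norm_num)]
  rw [this]; ring

theorem Lb_ge {x : ℝ} (hx : 0 < x) (j : ℕ) (h : x ≤ (1 / 2 : ℝ) ^ j) : (j : ℝ) ≤ Lb x := by
  have := Lb_anti hx h
  rwa [Lb_pow] at this

theorem Lb_le {x : ℝ} (j : ℕ) (h : (1 / 2 : ℝ) ^ j ≤ x) : Lb x ≤ (j : ℝ) := by
  have := Lb_anti (by positivity) h
  rwa [Lb_pow] at this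

theorem Lb_two {x : ℝ} (hx : 0 < x) : Lb (2 * x) = Lb x - 1 := by
  unfold Lb
  rw [Real.logb_mul (by norm_num) hx.ne', Real.logb_self_eq_one (by norm_num)]; ring

theorem Lb_sq {x : ℝ} : Lb (x ^ 2) = 2 * Lb x := by
  unfold Lb
  rw [Real.logb_pow]; push_cast; ring

/-- The one-sided potential. -/
def kk (x : ℝ) : ℝ :=
  if x ≤ (1 / 2 : ℝ) ^ 24 then 238016112 / Lb x else minLine certLines x

/-- The symmetric potential. -/
def hh (x : ℝ) : ℝ := kk (min x (1 - x))

theorem kk_tail {x : ℝ} (h : x ≤ (1 / 2 : ℝ) ^ 24) : kk x = 238016112 / Lb x := if_pos h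

theorem kk_mid {x : ℝ} (h : ¬ x ≤ (1 / 2 : ℝ) ^ 24) : kk x = minLine certLines x := if_neg h

theorem kk_le_pow {x : ℝ} (hx : 0 < x) (j : ℕ) (hj : 24 ≤ j) (h : x ≤ (1 / 2 : ℝ) ^ j) :
    kk x ≤ 238016112 / j := by
  have h2 : x ≤ (1 / 2 : ℝ) ^ 24 :=
    h.trans (pow_le_pow_of_le_one (by norm_num) (by norm_num) hj)
  rw [kk_tail h2]
  have := Lb_ge hx j h
  have hj' : (24 : ℝ) ≤ j := by exact_mod_cast hj
  gcongr

theorem kk_le_line {x : ℝ} (hx : 0 < x) (l : ℤ × ℤ) (hl : l ∈ certLines) : kk x ≤ lv l x := by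
  by_cases h : x ≤ (1 / 2 : ℝ) ^ 24
  · have h1 := kk_le_pow hx 24 le_rfl h
    obtain ⟨h2, h3⟩ := lines_prop l hl
    have := mul_nonneg h2 hx.le
    unfold lv
    push_cast at h1
    linarith
  · rw [kk_mid h]; exact minLine_le _ _ l hl

theorem kk_mono {x y : ℝ} (hx : 0 < x) (hxy : x ≤ y) : kk x ≤ kk y := by
  by_cases h : y ≤ (1 / 2 : ℝ) ^ 24
  · rw [kk_tail h, kk_tail (hxy.trans h)]
    have := Lb_ge (hx.trans_le hxy) 24 h
    have := Lb_anti hx hxy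
    push_cast at *
    gcongr
  · rw [kk_mid h]
    have key : ∀ l ∈ certLines, kk x ≤ lv l y := fun l hl =>
      (kk_le_line hx l hl).trans (by
        have := mul_le_mul_of_nonneg_left hxy (lines_prop l hl).1
        unfold lv; linarith)
    refine le_minLine _ _ _ ?_ key
    have := key _ top_mem
    simpa [lv] using this

theorem kk_ge {x : ℝ} (hx : 0 < x) (h : ¬ x ≤ (1 / 2 : ℝ) ^ 24) : 238016112 / 24 ≤ kk x := by
  have := kk_mono (x := (1 / 2 : ℝ) ^ 24) (by positivity) (not_le.1 h).le
  rw [kk_tail le_rfl, Lb_pow] at this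
  simpa using this

theorem kk_lower {x : ℝ} (hx : 0 < x) (hx2 : x ≤ 1 / 2) : 238016112 / (24 + Lb x) ≤ kk x := by
  have hL : 1 ≤ Lb x := by simpa using Lb_ge hx 1 (by simpa using hx2)
  by_cases h : x ≤ (1 / 2 : ℝ) ^ 24
  · rw [kk_tail h]
    gcongr; linarith
  · refine le_trans ?_ (kk_ge hx h)
    gcongr; linarith

theorem hh_symm (x : ℝ) : hh (1 - x) = hh x := by
  unfold hh; rw [min_comm]; congr 2; ring

theorem hh_eq {x : ℝ} (h : x ≤ 1 / 2) : hh x = kk x := by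
  unfold hh; rw [min_eq_left (by linarith)]

theorem hh_lower {x : ℝ} (hx : 0 < x) (hx2 : x ≤ 1 / 2) : 238016112 / (24 + Lb x) ≤ hh x := by
  rw [hh_eq hx2]; exact kk_lower hx hx2

theorem hh_pos {x : ℝ} (hx : 0 < x) (hx1 : x < 1) : 0 < hh x := by
  have key : ∀ y : ℝ, 0 < y → y ≤ 1 / 2 → 0 < kk y := fun y hy hy2 => by
    have hL : 1 ≤ Lb y := by simpa using Lb_ge hy 1 (by simpa using hy2)
    exact lt_of_lt_of_le (by positivity) (kk_lower hy hy2)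
  apply key
  · exact lt_min hx (by linarith)
  · rcases le_total x (1 / 2) with h | h
    · exact (min_le_left _ _).trans h
    · exact (min_le_right _ _).trans (by linarith)

theorem hh_mono {x y : ℝ} (hx : 0 < x) (hxy : x ≤ y) (hy : y ≤ 1 / 2) : hh x ≤ hh y := by
  rw [hh_eq hy, hh_eq (hxy.trans hy)]; exact kk_mono hx hxy

theorem hh_le_kk {x y : ℝ} (hx : 0 < x) (hx1 : x < 1) (hxy : x ≤ y) : hh x ≤ kk y :=
  kk_mono (lt_min hx (by linarith)) ((min_le_left _ _).trans hxy)

theorem hh_le_line {x : ℝ} (hx : 0 < x) (hx1 : x < 1) (l : ℤ × ℤ) (hl : l ∈ certLines) :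
    hh x ≤ (l.1 : ℝ) + l.2 * x := 
  (hh_le_kk hx hx1 le_rfl).trans (kk_le_line hx l hl)

theorem hh_le_line' {x : ℝ} (hx : 0 < x) (hx1 : x < 1) (l : ℤ × ℤ) (hl : l ∈ certLines) :
    hh x ≤ (l.1 : ℝ) + l.2 * (1 - x) := by
  rw [← hh_symm]
  exact hh_le_line (by linarith) (by linarith) l hl

theorem g_convex (a b s t : ℝ) (ha : 0 ≤ a) (ha2 : a ≤ 1 / 2) (hb : 0 ≤ b) (hb2 : b ≤ 1 / 2)
    (hs : 0 ≤ s) (ht : 0 ≤ t) (hst : s + t = 1) :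
    (s * a + t * b) ^ 2 * (80 - 11 * (1 - (s * a + t * b)) ^ 2) ≤
      s * (a ^ 2 * (80 - 11 * (1 - a) ^ 2)) + t * (b ^ 2 * (80 - 11 * (1 - b) ^ 2)) := by
  obtain rfl : s = 1 - t := by linarith
  set x := (1 - t) * a + t * b with hx
  have hx0 : 0 ≤ x := by positivity
  have hx2 : x ≤ 1 / 2 := by
    have := mul_le_mul_of_nonneg_left ha2 hs
    have := mul_le_mul_of_nonneg_left hb2 ht
    linarith
  have key : 0 ≤ ((1 - t) * t * (b - a) ^ 2) *
      (69 + 22 * (a + b + x) - 11 * (a ^ 2 + b ^ 2 + x ^ 2 + a * b + a * x + b * x)) := by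
    apply mul_nonneg (by positivity)
    nlinarith [mul_nonneg ha (sub_nonneg.2 ha2), mul_nonneg hb (sub_nonneg.2 hb2),
      mul_nonneg hx0 (sub_nonneg.2 hx2), mul_nonneg ha (sub_nonneg.2 hb2),
      mul_nonneg ha (sub_nonneg.2 hx2), mul_nonneg hb (sub_nonneg.2 hx2)]
  have e : (1 - t) * (a ^ 2 * (80 - 11 * (1 - a) ^ 2)) + t * (b ^ 2 * (80 - 11 * (1 - b) ^ 2))
      - x ^ 2 * (80 - 11 * (1 - x) ^ 2) = ((1 - t) * t * (b - a) ^ 2) *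
      (69 + 22 * (a + b + x) - 11 * (a ^ 2 + b ^ 2 + x ^ 2 + a * b + a * x + b * x)) := by
    rw [hx]; ring
  linarith

theorem node_prop {X V : ℤ} (h : nodeOK X V = true) (l : ℤ × ℤ) (hl : l ∈ certLines) :
    (V : ℝ) ≤ l.1 + l.2 * ((X : ℝ) / 1073741824) := by
  simp only [nodeOK, List.all_eq_true, decide_eq_true_eq, cS] at h
  have h1 := h l hl
  have h2 : (V : ℝ) * 1073741824 ≤ l.1 * 1073741824 + l.2 * X := by exact_mod_cast h1
  have : (l.2 : ℝ) * ((X : ℝ) / 1073741824) = l.2 * X / 1073741824 := by ring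
  rw [this]
  linarith

theorem dbl_prop {X V A B : ℤ} (h : dblAt X V A B = true) :
    (A : ℝ) + 2 * B * ((X : ℝ) / 1073741824) ≤ 1.62 * V := by
  simp only [dblAt, decide_eq_true_eq, cS] at h
  have h2 : (100 : ℝ) * (A * 1073741824 + 2 * B * X) ≤ 162 * 1073741824 * V := by exact_mod_cast h
  linarith

theorem tail_prop {X V A B : ℤ} {j : ℕ} (hj : 24 ≤ j) (h : tailAt X V j A B = true) :
    (238016112 : ℝ) / j + (A : ℝ) + 2 * B * ((X : ℝ) / 1073741824) ≤ 1.636 * V := by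
  simp only [tailAt, decide_eq_true_eq, cS, cK] at h
  have h2 : (250 : ℝ) * (238016112 * 1073741824 + j * (A * 1073741824 + 2 * B * X))
    ≤ 409 * j * 1073741824 * V := by exact_mod_cast h
  have hj' : (0 : ℝ) < j := by
    have : 0 < j := by omega
    exact_mod_cast this
  have e : (238016112 : ℝ) / j + (A : ℝ) + 2 * B * ((X : ℝ) / 1073741824)
    = (238016112 * 1073741824 + j * (A * 1073741824 + 2 * B * X)) / (j * 1073741824) := by
    field_simp
    ring
  rw [e, div_le_iff₀ (by positivity)]
  linarith

theorem mid_prop {X V Ap Bp C D : ℤ} (h : midAt X V Ap Bp C D = true) :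
    (Ap : ℝ) + C + Bp * ((((X : ℝ) / 1073741824) ^ 2 *
      (80 - 11 * (1 - (X : ℝ) / 1073741824) ^ 2)) / 80) + D * (2 * ((X : ℝ) / 1073741824)
      - (((X : ℝ) / 1073741824) ^ 2 * (80 - 11 * (1 - (X : ℝ) / 1073741824) ^ 2)) / 80)
      ≤ 1.636 * V := by
  simp only [midAt, decide_eq_true_eq, cS] at h
  have h2 : (250 : ℝ) * ((Ap + C) * (80 * 1073741824 ^ 4) + Bp * (X ^ 2 * (80 * 1073741824 ^ 2
    - 11 * (1073741824 - X) ^ 2))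
    + D * (2 * X * (80 * 1073741824 ^ 3) - X ^ 2 * (80 * 1073741824 ^ 2
    - 11 * (1073741824 - X) ^ 2))) ≤ 409 * V * (80 * 1073741824 ^ 4) := by exact_mod_cast h
  obtain ⟨e, he⟩ : ∃ e : ℝ, e = (X : ℝ) / 1073741824 := ⟨_, rfl⟩
  have hX : (X : ℝ) = e * 1073741824 := by rw [he]; ring
  rw [← he]
  rw [hX] at h2
  ring_nf at h2 ⊢
  linarith

/-- What a verified cell yields. -/
theorem cell_sound {a b : ℤ × ℤ × ℕ × ℕ × ℕ × ℕ} (h : cellOK a b = true) {x : ℝ}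
    (hx0 : 0 < x) (hxa : (a.1 : ℝ) / 1073741824 ≤ x) (hxb : x ≤ (b.1 : ℝ) / 1073741824)
    (hxt : ¬ x ≤ (1 / 2 : ℝ) ^ 24) :
    (∀ y, 0 < y → y < 1 → y ≤ 2 * x → hh y ≤ 1.62 * kk x) ∧
    (∀ y, 0 < y → y ≤ x ^ 2 * (80 - 11 * (1 - x) ^ 2) / 80 → 2 * x - y < 1 →
      hh (2 * x - y) + hh y ≤ 1.636 * kk x) := by
  simp only [cellOK, Bool.and_eq_true, decide_eq_true_eq] at h
  obtain ⟨⟨⟨⟨⟨⟨hna, hnb⟩, ha0⟩, hab⟩, hb2⟩, hd1, hd2⟩, hty⟩ := h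
  have ha0' : (0 : ℝ) ≤ a.1 := by exact_mod_cast ha0
  have hab' : (a.1 : ℝ) < b.1 := by exact_mod_cast hab
  have hb2' : (2 : ℝ) * b.1 ≤ 1073741824 := by exact_mod_cast hb2
  set ea := (a.1 : ℝ) / 1073741824 with hea
  set eb := (b.1 : ℝ) / 1073741824 with heb
  have hea0 : 0 ≤ ea := by positivity
  have heab : ea < eb := by rw [hea, heb]; linarith
  have heb2 : eb ≤ 1 / 2 := by rw [heb]; linarith
  obtain ⟨s, t, hs, ht, hst, hx⟩ : ∃ s t : ℝ, 0 ≤ s ∧ 0 ≤ t ∧ s + t = 1 ∧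
      x = s * ea + t * eb := by
    have hD : 0 < eb - ea := by linarith
    refine ⟨(eb - x) / (eb - ea), (x - ea) / (eb - ea), div_nonneg (by linarith) hD.le,
      div_nonneg (by linarith) hD.le, ?_, ?_⟩
    · field_simp; ring
    · field_simp; ring
  have hx2 : x ≤ 1 / 2 := hxb.trans heb2
  -- lower bound for the potential
  have hlow : s * a.2.1 + t * b.2.1 ≤ kk x := by
    rw [kk_mid hxt]
    have key : ∀ l ∈ certLines, s * a.2.1 + t * b.2.1 ≤ lv l x := by
      intro l hl
      have h1 := mul_le_mul_of_nonneg_left (node_prop hna l hl) hs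
      have h2 := mul_le_mul_of_nonneg_left (node_prop hnb l hl) ht
      rw [← hea] at h1
      rw [← heb] at h2
      unfold lv
      rw [hx]
      have e : (l.1 : ℝ) + l.2 * (s * ea + t * eb)
        = s * (l.1 + l.2 * ea) + t * (l.1 + l.2 * eb) := by
        linear_combination (-(l.1 : ℝ)) * hst
      linarith
    refine le_minLine _ _ _ ?_ key
    simpa [lv] using key _ top_mem
  constructor
  · intro y hy hy1 hyx
    have hl := lineAt_mem a.2.2.2.2.2
    generalize lineAt a.2.2.2.2.2 = l at *
    have h1 := mul_le_mul_of_nonneg_left (dbl_prop hd1) hs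
    have h2 := mul_le_mul_of_nonneg_left (dbl_prop hd2) ht
    rw [← hea] at h1
    rw [← heb] at h2
    have h3 := hh_le_line hy hy1 l hl
    have h4 := mul_le_mul_of_nonneg_left hyx (lines_prop l hl).1
    have e : (l.1 : ℝ) + l.2 * (2 * x) = s * (l.1 + 2 * l.2 * ea) + t * (l.1 + 2 * l.2 * eb) := by
      rw [hx]; linear_combination (-(l.1 : ℝ)) * hst
    linarith
  · intro y hy hyg hy1
    have hys : 0 < 2 * x - y := by
      have : x ^ 2 * (80 - 11 * (1 - x) ^ 2) / 80 ≤ x ^ 2 := by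
        have := mul_nonneg (sq_nonneg x) (sq_nonneg (1 - x))
        linarith
      have : x ^ 2 ≤ x * (1 / 2) := by rw [sq]; gcongr
      linarith
    have hy_lt : y < 1 := by
      by_contra hc
      linarith
    have hgx := g_convex ea eb s t hea0 (heab.le.trans heb2) (hea0.trans heab.le) heb2 hs ht hst
    rw [← hx] at hgx
    have mid : ∀ (lp : ℤ × ℤ) (C D : ℤ), lp ∈ certLines → D ≤ lp.2 →
        midAt a.1 a.2.1 lp.1 lp.2 C D = true → midAt b.1 b.2.1 lp.1 lp.2 C D = true →
        hh (2 * x - y) ≤ C + D * (2 * x - y) → hh (2 * x - y) + hh y ≤ 1.636 * kk x := by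
      intro lp C D hlp hD hma hmb hC
      have h1 := mul_le_mul_of_nonneg_left (mid_prop hma) hs
      have h2 := mul_le_mul_of_nonneg_left (mid_prop hmb) ht
      rw [← hea] at h1
      rw [← heb] at h2
      have h3 := hh_le_line hy hy_lt lp hlp
      have hD' : (0 : ℝ) ≤ (lp.2 : ℝ) - D := by
        have : (D : ℝ) ≤ lp.2 := by exact_mod_cast hD
        linarith
      have h4 := mul_le_mul_of_nonneg_left hyg hD'
      have h5 := mul_le_mul_of_nonneg_left hgx hD'
      generalize (ea ^ 2 * (80 - 11 * (1 - ea) ^ 2)) = ga at *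
      generalize (eb ^ 2 * (80 - 11 * (1 - eb) ^ 2)) = gb at *
      generalize (x ^ 2 * (80 - 11 * (1 - x) ^ 2)) = gx at *
      have e : (lp.1 : ℝ) + C + ((lp.2 : ℝ) - D) * (s * ga + t * gb) / 80 + D * (2 * x) =
        s * (lp.1 + C + lp.2 * (ga / 80) + D * (2 * ea - ga / 80)) +
        t * (lp.1 + C + lp.2 * (gb / 80) + D * (2 * eb - gb / 80)) := by
        rw [hx]; linear_combination (-(lp.1 : ℝ) - C) * hst
      linarith
    have hlp := lineAt_mem a.2.2.2.1
    have hls := lineAt_mem a.2.2.2.2.1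
    generalize lineAt a.2.2.2.1 = lp at *
    generalize lineAt a.2.2.2.2.1 = ls at *
    split_ifs at hty with ht0 ht1
    · simp only [Bool.and_eq_true, decide_eq_true_eq] at hty
      obtain ⟨⟨⟨hj, hjb⟩, hta⟩, htb⟩ := hty
      have h1 := mul_le_mul_of_nonneg_left (tail_prop hj hta) hs
      have h2 := mul_le_mul_of_nonneg_left (tail_prop hj htb) ht
      rw [← hea] at h1
      rw [← heb] at h2
      have hyj : y ≤ (1 / 2 : ℝ) ^ a.2.2.2.1 := by
        have h3 : y ≤ x ^ 2 := by
          have := mul_nonneg (sq_nonneg x) (sq_nonneg (1 - x))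
          linarith
        have h4 : x ^ 2 ≤ eb ^ 2 := by gcongr
        have h5 : (2 : ℝ) ^ a.2.2.2.1 * b.1 ^ 2 ≤ 1073741824 ^ 2 := by exact_mod_cast hjb
        have h6 : eb ^ 2 ≤ (1 / 2 : ℝ) ^ a.2.2.2.1 := by
          rw [heb, div_pow, div_pow, one_pow, div_le_div_iff₀ (by positivity) (by positivity)]
          linarith
        linarith
      have h3 : hh y ≤ 238016112 / a.2.2.2.1 :=
        (hh_le_kk hy hy_lt le_rfl).trans (kk_le_pow hy _ hj hyj)
      have h4 := hh_le_line hys hy1 ls hls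
      have h5 := mul_nonneg (lines_prop ls hls).1 hy.le
      generalize (238016112 : ℝ) / a.2.2.2.1 = kj at *
      have e : kj + ls.1 + ls.2 * (2 * x) = s * (kj + ls.1 + 2 * ls.2 * ea) +
          t * (kj + ls.1 + 2 * ls.2 * eb) := by
        rw [hx]; linear_combination (-(ls.1 : ℝ) - kj) * hst
      linarith
    · simp only [Bool.and_eq_true, decide_eq_true_eq] at hty
      exact mid lp ls.1 ls.2 hlp hty.1.1 hty.1.2 hty.2 (hh_le_line hys hy1 ls hls)
    · simp only [Bool.and_eq_true] at hty
      refine mid lp (ls.1 + ls.2) (-ls.2) hlp ?_ hty.1 hty.2 ?_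
      · have h1 := (lines_prop lp hlp).1
        have h2 := (lines_prop ls hls).1
        have h1' : 0 ≤ lp.2 := by exact_mod_cast h1
        have h2' : 0 ≤ ls.2 := by exact_mod_cast h2
        linarith
      · have := hh_le_line' hys hy1 ls hls
        push_cast
        linarith

theorem walk_sound' (L : List (ℤ × ℤ × ℕ × ℕ × ℕ × ℕ)) : ∀ a b, walkOK (a :: b :: L) = true →
    ∀ x : ℝ, (a.1 : ℝ) / 1073741824 ≤ x → x ≤ 1 / 2 →
    ∃ c d, cellOK c d = true ∧ (c.1 : ℝ) / 1073741824 ≤ x ∧ x ≤ (d.1 : ℝ) / 1073741824 := by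
  induction L with
  | nil =>
    intro a b h x hx hx2
    simp only [walkOK, decide_eq_true_eq, cS, Bool.and_eq_true] at h
    have : (2 : ℝ) * b.1 = 1073741824 := by exact_mod_cast h.2
    exact ⟨a, b, h.1, hx, by linarith⟩
  | cons d L ih =>
    intro a b h x hx hx2
    rw [walkOK, Bool.and_eq_true] at h
    rcases le_total x ((b.1 : ℝ) / 1073741824) with hb | hb
    · exact ⟨a, b, h.1, hx, hb⟩
    · exact ih b d h.2 x hb hx2

theorem cell_exists {x : ℝ} (hx : (1 / 2 : ℝ) ^ 24 ≤ x) (hx2 : x ≤ 1 / 2) :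
    ∃ c d, cellOK c d = true ∧ (c.1 : ℝ) / 1073741824 ≤ x ∧ x ≤ (d.1 : ℝ) / 1073741824 := by
  have h := walkOK_true
  unfold certRows at h
  refine walk_sound' _ _ _ h x ?_ hx2
  norm_num at hx ⊢
  linarith

theorem kk_double {x y : ℝ} (hx : 0 < x) (hx2 : x ≤ (1 / 2 : ℝ) ^ 24) (hy : 0 < y) (hy1 : y < 1)
    (hyx : y ≤ 2 * x) : hh y ≤ 1.1 * kk x := by
  have hL := Lb_ge hx 24 hx2
  push_cast at hL
  have h1 := hh_le_kk hy hy1 hyx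
  refine h1.trans ?_
  by_cases h : 2 * x ≤ (1 / 2 : ℝ) ^ 24
  · rw [kk_tail h, kk_tail hx2, Lb_two hx]
    rw [← mul_div_assoc, div_le_div_iff₀ (by linarith) (by linarith)]
    linarith
  · have h2 := kk_le_line (x := 2 * x) (by linarith) (lineAt 0) (lineAt_mem 0)
    have e : lineAt 0 = (9917338, 3298277790215) := by decide +kernel
    rw [e] at h2
    simp only [lv] at h2
    have h3 : Lb x ≤ 25 := by
      have := Lb_le (x := x) 25 (by rw [pow_succ]; linarith)
      simpa using this
    have h4 : (238016112 : ℝ) / 25 ≤ kk x := by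
      rw [kk_tail hx2]
      gcongr
    norm_num at h2 hx2 ⊢
    linarith

theorem hh_double {x y : ℝ} (hx : 0 < x) (hx2 : x ≤ 1 / 2) (hy : 0 < y) (hy1 : y < 1)
    (hyx : y ≤ 2 * x) : hh y ≤ 1.62 * hh x := by
  rw [hh_eq hx2]
  by_cases h : x ≤ (1 / 2 : ℝ) ^ 24
  · have := kk_double hx h hy hy1 hyx
    have h2 := hh_pos hx (by linarith)
    rw [hh_eq hx2] at h2
    linarith
  · obtain ⟨c, d, h1, h2, h3⟩ := cell_exists (not_le.1 h).le hx2
    exact (cell_sound h1 hx h2 h3 h).1 y hy hy1 hyx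

theorem hh_contract {x y : ℝ} (hx : 0 < x) (hx2 : x ≤ 1 / 2) (hy : 0 < y)
    (hyx : y ≤ x ^ 2 - 11 / 80 * (x * (1 - x)) ^ 2) (hy1 : 2 * x - y < 1) :
    hh (2 * x - y) + hh y ≤ 1.636 * hh x := by
  rw [hh_eq hx2]
  by_cases h : x ≤ (1 / 2 : ℝ) ^ 24
  · have hyx2 : y ≤ x ^ 2 := by
      have := sq_nonneg (x * (1 - x))
      linarith
    have hxx : x ^ 2 ≤ x * (1 / 2) := by rw [sq]; gcongr
    have h1 := kk_double hx h (y := 2 * x - y) (by linarith) hy1 (by linarith)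
    have h2 : hh y ≤ kk x / 2 := by
      have h3 := hh_le_kk hy (by linarith) hyx2
      have hL := Lb_ge hx 24 h
      push_cast at hL
      rw [kk_tail (by linarith), Lb_sq] at h3
      rw [kk_tail h]
      refine h3.trans (le_of_eq ?_)
      field_simp
    have h2' := hh_pos hx (by linarith)
    rw [hh_eq hx2] at h2'
    linarith
  · obtain ⟨c, d, h1, h2, h3⟩ := cell_exists (not_le.1 h).le hx2
    refine (cell_sound h1 hx h2 h3 h).2 y hy ?_ hy1
    refine hyx.trans (le_of_eq ?_)
    ring

/-- `E(W^s) / (E y)`. -/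
def tM (z κ : ℝ) : ℝ := 2 - z * (2 / 3 + κ / 6)

/-- `1 - k z²`. -/
def tkz (z κ : ℝ) : ℝ := 1 - (1 + κ) / 12 * z ^ 2

/-- First bound for the inertia of the serial child. -/
def trapI (z κ : ℝ) : ℝ := κ * (1 - z ^ 2 * (1 - 2 * κ) / 36)

/-- Second bound for the inertia of the serial child. -/
def trapII (z κ : ℝ) : ℝ :=
  κ * (1 - z / 2) ^ 2 + (1 - z / 2) * z * (2 - κ) / 3 + z ^ 2 * (2 - κ) ^ 2 / 18

set_option maxHeartbeats 2000000 in
theorem trapB1I_aux (a b u v : ℝ) (ha : 0 ≤ a) (hb : 0 ≤ b) (hu : 0 ≤ u) (hv : 0 ≤ v) :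
    0 ≤ 4800000000000 / 18755369578009 * (a ^ 0 * b ^ 6) * (u ^ 1 * v ^ 4)
      + 19200000000000 / 18755369578009 * (a ^ 0 * b ^ 6) * (u ^ 2 * v ^ 3)
      + 28800000000000 / 18755369578009 * (a ^ 0 * b ^ 6) * (u ^ 3 * v ^ 2)
      + 19200000000000 / 18755369578009 * (a ^ 0 * b ^ 6) * (u ^ 4 * v ^ 1)
      + 4800000000000 / 18755369578009 * (a ^ 0 * b ^ 6) * (u ^ 5 * v ^ 0)
      + 84800000000 / 14843206598547 * (a ^ 1 * b ^ 5) * (u ^ 0 * v ^ 5)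
      + 447767200000000 / 2419442675563161 * (a ^ 1 * b ^ 5) * (u ^ 1 * v ^ 4)
      + 1622852800000000 / 2419442675563161 * (a ^ 1 * b ^ 5) * (u ^ 2 * v ^ 3)
      + 2320179200000000 / 2419442675563161 * (a ^ 1 * b ^ 5) * (u ^ 3 * v ^ 2)
      + 1493756800000000 / 2419442675563161 * (a ^ 1 * b ^ 5) * (u ^ 4 * v ^ 1)
      + 362485600000000 / 2419442675563161 * (a ^ 1 * b ^ 5) * (u ^ 5 * v ^ 0)
      + 135706576000000 / 44529619795641 * (a ^ 2 * b ^ 4) * (u ^ 0 * v ^ 5)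
      + 103037873830000000 / 7258328026689483 * (a ^ 2 * b ^ 4) * (u ^ 1 * v ^ 4)
      + 190451726843000000 / 7258328026689483 * (a ^ 2 * b ^ 4) * (u ^ 2 * v ^ 3)
      + 174324342629000000 / 7258328026689483 * (a ^ 2 * b ^ 4) * (u ^ 3 * v ^ 2)
      + 26281380203000000 / 2419442675563161 * (a ^ 2 * b ^ 4) * (u ^ 4 * v ^ 1)
      + 4684607627000000 / 2419442675563161 * (a ^ 2 * b ^ 4) * (u ^ 5 * v ^ 0)
      + 388038745720000 / 44529619795641 * (a ^ 3 * b ^ 3) * (u ^ 0 * v ^ 5)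
      + 100118851751120000 / 2419442675563161 * (a ^ 3 * b ^ 3) * (u ^ 1 * v ^ 4)
      + 568356682939930000 / 7258328026689483 * (a ^ 3 * b ^ 3) * (u ^ 2 * v ^ 3)
      + 4150639837670000 / 56266108734027 * (a ^ 3 * b ^ 3) * (u ^ 3 * v ^ 2)
      + 250969672550710000 / 7258328026689483 * (a ^ 3 * b ^ 3) * (u ^ 4 * v ^ 1)
      + 5198619636690000 / 806480891854387 * (a ^ 3 * b ^ 3) * (u ^ 5 * v ^ 0)
      + 1141543876996400 / 133588859386923 * (a ^ 4 * b ^ 2) * (u ^ 0 * v ^ 5)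
      + 877100263193841850 / 21774984080068449 * (a ^ 4 * b ^ 2) * (u ^ 1 * v ^ 4)
      + 1646864820253481350 / 21774984080068449 * (a ^ 4 * b ^ 2) * (u ^ 2 * v ^ 3)
      + 3077458550647231225 / 43549968160136898 * (a ^ 4 * b ^ 2) * (u ^ 3 * v ^ 2)
      + 238303470822964525 / 7258328026689483 * (a ^ 4 * b ^ 2) * (u ^ 4 * v ^ 1)
      + 29337188034517925 / 4838885351126322 * (a ^ 4 * b ^ 2) * (u ^ 5 * v ^ 0)
      + 467921789531200 / 133588859386923 * (a ^ 5 * b ^ 1) * (u ^ 0 * v ^ 5)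
      + 351934299379237840 / 21774984080068449 * (a ^ 5 * b ^ 1) * (u ^ 1 * v ^ 4)
      + 645819302955616055 / 21774984080068449 * (a ^ 5 * b ^ 1) * (u ^ 2 * v ^ 3)
      + 588498536345648240 / 21774984080068449 * (a ^ 5 * b ^ 1) * (u ^ 3 * v ^ 2)
      + 39396126505495065 / 3225923567417548 * (a ^ 5 * b ^ 1) * (u ^ 4 * v ^ 1)
      + 7049121901689965 / 3225923567417548 * (a ^ 5 * b ^ 1) * (u ^ 5 * v ^ 0)
      + 206387418267200 / 400766578160769 * (a ^ 6 * b ^ 0) * (u ^ 0 * v ^ 5)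
      + 150541115083426280 / 65324952240205347 * (a ^ 6 * b ^ 0) * (u ^ 1 * v ^ 4)
      + 6213561046128707 / 1519184935818729 * (a ^ 6 * b ^ 0) * (u ^ 2 * v ^ 3)
      + 625381021262380381 / 174199872640547592 * (a ^ 6 * b ^ 0) * (u ^ 3 * v ^ 2)
      + 90188605182173335 / 58066624213515864 * (a ^ 6 * b ^ 0) * (u ^ 4 * v ^ 1)
      + 20417032093528613 / 77422165618021152 * (a ^ 6 * b ^ 0) * (u ^ 5 * v ^ 0) := by
  positivity

set_option maxHeartbeats 2000000 in
theorem trapB1I (z κ : ℝ) (hz0 : 0 ≤ z) (hz1 : z ≤ 163 / 100) (hk0 : 0 ≤ κ) (hk1 : κ ≤ 1 / 2) :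
    0 ≤ tM z κ ^ 2 - trapI z κ / 10 - 1.29 * (2 * ((1 - κ / 10) / 1.29) - z * ((1 - κ / 10) / 1.29) ^ 2
      + (1 + κ) / 12 * z * (1 - z * ((1 - κ / 10) / 1.29)) ^ 2) * tkz z κ * tM z κ := by
  have h := trapB1I_aux (z) (163 / 100 - z) (κ) (1 / 2 - κ) (by linarith) (by linarith)
    (by linarith) (by linarith)
  refine h.trans (le_of_eq ?_)
  unfold tM tkz trapI
  ring

set_option maxHeartbeats 2000000 in
theorem trapB1II_aux (a b u v : ℝ) (ha : 0 ≤ a) (hb : 0 ≤ b) (hu : 0 ≤ u) (hv : 0 ≤ v) :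
    0 ≤ 1600000000000 / 1519184935818729 * (a ^ 0 * b ^ 6) * (u ^ 0 * v ^ 5)
      + 12800000000000 / 1519184935818729 * (a ^ 0 * b ^ 6) * (u ^ 1 * v ^ 4)
      + 35200000000000 / 1519184935818729 * (a ^ 0 * b ^ 6) * (u ^ 2 * v ^ 3)
      + 44800000000000 / 1519184935818729 * (a ^ 0 * b ^ 6) * (u ^ 3 * v ^ 2)
      + 27200000000000 / 1519184935818729 * (a ^ 0 * b ^ 6) * (u ^ 4 * v ^ 1)
      + 6400000000000 / 1519184935818729 * (a ^ 0 * b ^ 6) * (u ^ 5 * v ^ 0)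
      + 362485600000000 / 587924570161848123 * (a ^ 1 * b ^ 5) * (u ^ 0 * v ^ 5)
      + 4114169600000000 / 587924570161848123 * (a ^ 1 * b ^ 5) * (u ^ 1 * v ^ 4)
      + 12561894400000000 / 587924570161848123 * (a ^ 1 * b ^ 5) * (u ^ 2 * v ^ 3)
      + 16625521600000000 / 587924570161848123 * (a ^ 1 * b ^ 5) * (u ^ 3 * v ^ 2)
      + 237432800000000 / 13672664422368561 * (a ^ 1 * b ^ 5) * (u ^ 4 * v ^ 1)
      + 2394299200000000 / 587924570161848123 * (a ^ 1 * b ^ 5) * (u ^ 5 * v ^ 0)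
      + 4684607627000000 / 587924570161848123 * (a ^ 2 * b ^ 4) * (u ^ 0 * v ^ 5)
      + 21211062491000000 / 587924570161848123 * (a ^ 2 * b ^ 4) * (u ^ 1 * v ^ 4)
      + 94202069000000 / 1519184935818729 * (a ^ 2 * b ^ 4) * (u ^ 2 * v ^ 3)
      + 28900479233000000 / 587924570161848123 * (a ^ 2 * b ^ 4) * (u ^ 3 * v ^ 2)
      + 9853568186000000 / 587924570161848123 * (a ^ 2 * b ^ 4) * (u ^ 4 * v ^ 1)
      + 294278264000000 / 195974856720616041 * (a ^ 2 * b ^ 4) * (u ^ 5 * v ^ 0)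
      + 1732873212230000 / 65324952240205347 * (a ^ 3 * b ^ 3) * (u ^ 0 * v ^ 5)
      + 24314142630230000 / 195974856720616041 * (a ^ 3 * b ^ 3) * (u ^ 1 * v ^ 4)
      + 44699990312710000 / 195974856720616041 * (a ^ 3 * b ^ 3) * (u ^ 2 * v ^ 3)
      + 13399103410750000 / 65324952240205347 * (a ^ 3 * b ^ 3) * (u ^ 3 * v ^ 2)
      + 17558121863840000 / 195974856720616041 * (a ^ 3 * b ^ 3) * (u ^ 4 * v ^ 1)
      + 68494859320000 / 4557554807456187 * (a ^ 3 * b ^ 3) * (u ^ 5 * v ^ 0)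
      + 29337188034517925 / 1175849140323696246 * (a ^ 4 * b ^ 2) * (u ^ 0 * v ^ 5)
      + 66332152882214725 / 587924570161848123 * (a ^ 4 * b ^ 2) * (u ^ 1 * v ^ 4)
      + 235807516715234425 / 1175849140323696246 * (a ^ 4 * b ^ 2) * (u ^ 2 * v ^ 3)
      + 102506275324084900 / 587924570161848123 * (a ^ 4 * b ^ 2) * (u ^ 3 * v ^ 2)
      + 43318683047127250 / 587924570161848123 * (a ^ 4 * b ^ 2) * (u ^ 4 * v ^ 1)
      + 7052607215703800 / 587924570161848123 * (a ^ 4 * b ^ 2) * (u ^ 5 * v ^ 0)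
      + 7049121901689965 / 783899426882464164 * (a ^ 5 * b ^ 1) * (u ^ 0 * v ^ 5)
      + 89447304511942315 / 2351698280647392492 * (a ^ 5 * b ^ 1) * (u ^ 1 * v ^ 4)
      + 12399246436873900 / 195974856720616041 * (a ^ 5 * b ^ 1) * (u ^ 2 * v ^ 3)
      + 10045802781726625 / 195974856720616041 * (a ^ 5 * b ^ 1) * (u ^ 3 * v ^ 2)
      + 11728455486679720 / 587924570161848123 * (a ^ 5 * b ^ 1) * (u ^ 4 * v ^ 1)
      + 571267250134480 / 195974856720616041 * (a ^ 5 * b ^ 1) * (u ^ 5 * v ^ 0)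
      + 20417032093528613 / 18813586245179139936 * (a ^ 6 * b ^ 0) * (u ^ 0 * v ^ 5)
      + 9868831882734865 / 2351698280647392492 * (a ^ 6 * b ^ 0) * (u ^ 1 * v ^ 4)
      + 30409056008751541 / 4703396561294784984 * (a ^ 6 * b ^ 0) * (u ^ 2 * v ^ 3)
      + 5693235909056821 / 1175849140323696246 * (a ^ 6 * b ^ 0) * (u ^ 3 * v ^ 2)
      + 112327234209302 / 65324952240205347 * (a ^ 6 * b ^ 0) * (u ^ 4 * v ^ 1)
      + 43669496331496 / 195974856720616041 * (a ^ 6 * b ^ 0) * (u ^ 5 * v ^ 0) := by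
  positivity

set_option maxHeartbeats 2000000 in
theorem trapB1II (z κ : ℝ) (hz0 : 0 ≤ z) (hz1 : z ≤ 163 / 100) (hk0 : 1 / 2 ≤ κ) (hk1 : κ ≤ 2) :
    0 ≤ tM z κ ^ 2 - trapII z κ / 10 - 1.29 * (2 * ((1 - κ / 10) / 1.29) - z * ((1 - κ / 10) / 1.29) ^ 2
      + (1 + κ) / 12 * z * (1 - z * ((1 - κ / 10) / 1.29)) ^ 2) * tkz z κ * tM z κ := by
  have h := trapB1II_aux (z) (163 / 100 - z) (κ - 1 / 2) (2 - κ) (by linarith) (by linarith)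
    (by linarith) (by linarith)
  refine h.trans (le_of_eq ?_)
  unfold tM tkz trapII
  ring

set_option maxHeartbeats 2000000 in
theorem trapB2I_aux (a b u v : ℝ) (ha : 0 ≤ a) (hb : 0 ≤ b) (hu : 0 ≤ u) (hv : 0 ≤ v) :
    0 ≤ 1154421 / 252050 * (a ^ 0 * b ^ 3) * (u ^ 0 * v ^ 2)
      + 1061365431 / 143164400 * (a ^ 0 * b ^ 3) * (u ^ 1 * v ^ 1)
      + 818702757 / 286328800 * (a ^ 0 * b ^ 3) * (u ^ 2 * v ^ 0)
      + 85094 / 5041 * (a ^ 1 * b ^ 2) * (u ^ 0 * v ^ 2)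
      + 19352947 / 715822 * (a ^ 1 * b ^ 2) * (u ^ 1 * v ^ 1)
      + 14711155 / 1431644 * (a ^ 1 * b ^ 2) * (u ^ 2 * v ^ 0)
      + 216800 / 15123 * (a ^ 2 * b ^ 1) * (u ^ 0 * v ^ 2)
      + 22189600 / 1073733 * (a ^ 2 * b ^ 1) * (u ^ 1 * v ^ 1)
      + 2332250 / 357911 * (a ^ 2 * b ^ 1) * (u ^ 2 * v ^ 0)
      + 160000 / 45369 * (a ^ 3 * b ^ 0) * (u ^ 0 * v ^ 2)
      + 13840000 / 3221199 * (a ^ 3 * b ^ 0) * (u ^ 1 * v ^ 1)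
      + 310000 / 357911 * (a ^ 3 * b ^ 0) * (u ^ 2 * v ^ 0) := by
  positivity

set_option maxHeartbeats 2000000 in
theorem trapB2I (z κ : ℝ) (hz0 : 129 / 100 ≤ z) (hz1 : z ≤ 2) (hk0 : 0 ≤ κ) (hk1 : κ ≤ 1 / 2) :
    0 ≤ z * (tM z κ ^ 2 - trapI z κ / 10) - 1.29 * tkz z κ * tM z κ := by
  have h := trapB2I_aux (z - 129 / 100) (2 - z) (κ) (1 / 2 - κ) (by linarith) (by linarith)
    (by linarith) (by linarith)
  refine h.trans (le_of_eq ?_)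
  unfold tM tkz trapI
  ring

set_option maxHeartbeats 2000000 in
theorem trapB2II_aux (a b u v : ℝ) (ha : 0 ≤ a) (hb : 0 ≤ b) (hu : 0 ≤ u) (hv : 0 ≤ v) :
    0 ≤ 90966973 / 286328800 * (a ^ 0 * b ^ 3) * (u ^ 0 * v ^ 2)
      + 159229 / 403280 * (a ^ 0 * b ^ 3) * (u ^ 1 * v ^ 1)
      + 731 / 7100 * (a ^ 0 * b ^ 3) * (u ^ 2 * v ^ 0)
      + 14711155 / 12884796 * (a ^ 1 * b ^ 2) * (u ^ 0 * v ^ 2)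
      + 127349 / 90738 * (a ^ 1 * b ^ 2) * (u ^ 1 * v ^ 1)
      + 244 / 639 * (a ^ 1 * b ^ 2) * (u ^ 2 * v ^ 0)
      + 2332250 / 3221199 * (a ^ 2 * b ^ 1) * (u ^ 0 * v ^ 2)
      + 24400 / 45369 * (a ^ 2 * b ^ 1) * (u ^ 1 * v ^ 1)
      + 310000 / 3221199 * (a ^ 3 * b ^ 0) * (u ^ 0 * v ^ 2) := by
  positivity

set_option maxHeartbeats 2000000 in
theorem trapB2II (z κ : ℝ) (hz0 : 129 / 100 ≤ z) (hz1 : z ≤ 2) (hk0 : 1 / 2 ≤ κ) (hk1 : κ ≤ 2) :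
    0 ≤ z * (tM z κ ^ 2 - trapII z κ / 10) - 1.29 * tkz z κ * tM z κ := by
  have h := trapB2II_aux (z - 129 / 100) (2 - z) (κ - 1 / 2) (2 - κ) (by linarith) (by linarith)
    (by linarith) (by linarith)
  refine h.trans (le_of_eq ?_)
  unfold tM tkz trapII
  ring

theorem trap_pos {z κ : ℝ} (hz0 : 0 < z) (hz2 : z < 2) (hk0 : 0 ≤ κ) (hk2 : κ ≤ 2) :
    0 < tM z κ ∧ 0 < tkz z κ ∧ tkz z κ < 1 := by
  refine ⟨?_, ?_, ?_⟩
  · unfold tM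
    have : z * (2 / 3 + κ / 6) ≤ z * 1 := by gcongr; linarith
    linarith
  · unfold tkz
    have h1 : (1 + κ) / 12 * z ^ 2 ≤ 1 / 4 * z ^ 2 :=
      mul_le_mul_of_nonneg_right (by linarith) (sq_nonneg z)
    have h2 : z ^ 2 < 4 := by nlinarith
    linarith
  · unfold tkz
    have : 0 < (1 + κ) / 12 * z ^ 2 := by positivity
    linarith

theorem trap_B1 {z κ a : ℝ} (hz0 : 0 < z) (hk0 : 0 ≤ κ) (hk2 : κ ≤ 2)
    (haI : a ≤ trapI z κ) (haII : a ≤ trapII z κ) (hz : z * (1 - κ / 10) ≤ 1.29) :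
    1.29 * (2 * ((1 - κ / 10) / 1.29) - z * ((1 - κ / 10) / 1.29) ^ 2
      + (1 + κ) / 12 * z * (1 - z * ((1 - κ / 10) / 1.29)) ^ 2) * tkz z κ * tM z κ
      ≤ tM z κ ^ 2 - a / 10 := by
  have hz1 : z ≤ 163 / 100 := by
    have : z * (8 / 10) ≤ z * (1 - κ / 10) := by gcongr; linarith
    norm_num at hz
    linarith
  rcases le_total κ (1 / 2) with h | h
  · have := trapB1I z κ hz0.le hz1 hk0 h
    linarith
  · have := trapB1II z κ hz0.le hz1 h hk2
    linarith

theorem trap_B2 {z κ a : ℝ} (hz0 : 0 < z) (hz2 : z ≤ 2) (hk0 : 0 ≤ κ) (hk2 : κ ≤ 2)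
    (haI : a ≤ trapI z κ) (haII : a ≤ trapII z κ) (hz : 1.29 ≤ z * (1 - κ / 10)) :
    1.29 * tkz z κ * tM z κ ≤ z * (tM z κ ^ 2 - a / 10) := by
  have hz1 : 129 / 100 ≤ z := by
    have : z * (1 - κ / 10) ≤ z * 1 := by gcongr; linarith
    norm_num at hz
    linarith
  rcases le_total κ (1 / 2) with h | h
  · have := trapB2I z κ hz1 hz2 hk0 h
    have := mul_le_mul_of_nonneg_left haI hz0.le
    linarith
  · have := trapB2II z κ hz1 hz2 h hk2
    have := mul_le_mul_of_nonneg_left haII hz0.le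
    linarith

/-- `H(W^s) / x` in the reduced coordinates. -/
def tphi (z κ x : ℝ) : ℝ := (2 - x) + (1 + κ) / 12 * z ^ 2 * (1 - x) ^ 2 / x

theorem tphi_mul {z κ x : ℝ} (hx : 0 < x) :
    tphi z κ x * x = 1 - (1 - x) ^ 2 * tkz z κ := by
  unfold tphi tkz
  field_simp
  ring

theorem tphi_diff {z κ x v : ℝ} (hk0 : 0 ≤ κ) (hv : 0 < v) (hvx : v ≤ x) (hx1 : x ≤ 1) :
    tphi z κ x + (x - v) ≤ tphi z κ v := by
  have hx : 0 < x := hv.trans_le hvx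
  unfold tphi
  have h1 : (1 + κ) / 12 * z ^ 2 * (1 - x) ^ 2 / x ≤ (1 + κ) / 12 * z ^ 2 * (1 - v) ^ 2 / v := by
    have : 0 ≤ 1 - x := by linarith
    gcongr
  linarith

theorem tphi_le {z κ x : ℝ} (hz0 : 0 < z) (hz2 : z < 2) (hk0 : 0 ≤ κ) (hk2 : κ ≤ 2)
    (hx : 1 / 2 ≤ x) : tphi z κ x ≤ 2 := by
  have hx0 : 0 < x := by linarith
  have h := tphi_mul (z := z) (κ := κ) hx0
  have h2 := (trap_pos hz0 hz2 hk0 hk2).2.1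
  have h3 := mul_nonneg (sq_nonneg (1 - x)) h2.le
  by_contra hc
  have : 2 * x < tphi z κ x * x := mul_lt_mul_of_pos_right (not_le.1 hc) hx0
  linarith

theorem tphi_at {z κ c : ℝ} (hz : 0 < z) (hc : 0 < c) :
    1.29 * (2 * (c / 1.29) - z * (c / 1.29) ^ 2
      + (1 + κ) / 12 * z * (1 - z * (c / 1.29)) ^ 2) = c * tphi z κ (z * c / 1.29) := by
  unfold tphi
  field_simp

theorem trap_core1 {z κ a x g : ℝ} (hz0 : 0 < z) (hz2 : z < 2) (hk0 : 0 ≤ κ) (hk2 : κ ≤ 2)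
    (haI : a ≤ trapI z κ) (haII : a ≤ trapII z κ) (hx : 0 < x) (hx1 : x < 1)
    (hz : z * (1 - κ / 10) / 1.29 ≤ x)
    (hg : g * tphi z κ x ≤ tphi z κ (z * (1 - κ / 10) / 1.29)) :
    g * ((1 - κ / 10) * tM z κ * (1 - (1 - x) ^ 2 * tkz z κ) * tkz z κ) ≤
      (tM z κ ^ 2 - a / 10) * x := by
  obtain ⟨hM, hR, -⟩ := trap_pos hz0 hz2 hk0 hk2
  have hc : 0 < 1 - κ / 10 := by linarith
  set v := z * (1 - κ / 10) / 1.29 with hv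
  have hv0 : 0 < v := by positivity
  have hB := trap_B1 hz0 hk0 hk2 haI haII (by
    have : z * (1 - κ / 10) = 1.29 * v := by rw [hv]; ring
    rw [this]; linarith)
  have e : 1.29 * (2 * ((1 - κ / 10) / 1.29) - z * ((1 - κ / 10) / 1.29) ^ 2
      + (1 + κ) / 12 * z * (1 - z * ((1 - κ / 10) / 1.29)) ^ 2) = (1 - κ / 10) * tphi z κ v := by
    rw [hv]
    exact tphi_at hz0 hc
  rw [e] at hB
  rw [← tphi_mul hx]
  have h1 : (1 - κ / 10) * (g * tphi z κ x) * tkz z κ * tM z κ ≤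
      (1 - κ / 10) * tphi z κ v * tkz z κ * tM z κ := by gcongr
  have h2 := mul_le_mul_of_nonneg_right (h1.trans hB) hx.le
  refine le_trans (le_of_eq ?_) h2
  ring

theorem trap_core2 {z κ a x : ℝ} (hz0 : 0 < z) (hz2 : z < 2) (hk0 : 0 ≤ κ) (hk2 : κ ≤ 2)
    (haI : a ≤ trapI z κ) (haII : a ≤ trapII z κ) (hx : 0 < x) (hx1 : x < 1)
    (hz : x ≤ z * (1 - κ / 10) / 1.29) :
    1.29 * (tM z κ * (1 - (1 - x) ^ 2 * tkz z κ) * tkz z κ) ≤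
      (tM z κ ^ 2 - a / 10) * z := by
  obtain ⟨hM, hR, -⟩ := trap_pos hz0 hz2 hk0 hk2
  have hc : 0 < 1 - κ / 10 := by linarith
  rcases le_total (z * (1 - κ / 10) / 1.29) 1 with hv1 | hv1
  · -- compare with the value at `v`
    set v := z * (1 - κ / 10) / 1.29 with hv
    have hv0 : 0 < v := by positivity
    rcases eq_or_lt_of_le hv1 with h1 | h1
    · have hB := trap_B2 hz0 hz2.le hk0 hk2 haI haII (by
        have : z * (1 - κ / 10) = 1.29 * v := by rw [hv]; ring
        rw [this]; linarith)
      have : (1 - (1 - x) ^ 2 * tkz z κ) ≤ 1 := by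
        have := mul_nonneg (sq_nonneg (1 - x)) hR.le
        linarith
      calc 1.29 * (tM z κ * (1 - (1 - x) ^ 2 * tkz z κ) * tkz z κ)
          ≤ 1.29 * (tM z κ * 1 * tkz z κ) := by gcongr
        _ ≤ _ := by linarith
    · have h := trap_core1 (g := 1) hz0 hz2 hk0 hk2 haI haII hv0 h1 le_rfl (by rw [one_mul])
      have h3 : (1 - x) ^ 2 ≥ (1 - v) ^ 2 := by
        have : 0 ≤ 1 - v := by linarith
        gcongr
      have h4 : 1 - (1 - x) ^ 2 * tkz z κ ≤ 1 - (1 - v) ^ 2 * tkz z κ := by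
        have := mul_le_mul_of_nonneg_right h3 hR.le
        linarith
      have h5 : 1.29 * (tM z κ * (1 - (1 - x) ^ 2 * tkz z κ) * tkz z κ) ≤
        1.29 * (tM z κ * (1 - (1 - v) ^ 2 * tkz z κ) * tkz z κ) := by gcongr
      refine h5.trans ?_
      have e : v = z * ((1 - κ / 10) / 1.29) := by rw [hv]; ring
      have hd : 0 < (1 - κ / 10) / 1.29 := by positivity
      rw [one_mul] at h
      have h6 : (1 - κ / 10) / 1.29 *
          (1.29 * (tM z κ * (1 - (1 - v) ^ 2 * tkz z κ) * tkz z κ)) ≤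
          (1 - κ / 10) / 1.29 * ((tM z κ ^ 2 - a / 10) * z) := by
        refine le_trans (le_of_eq ?_) (h.trans (le_of_eq ?_))
        · ring
        · nth_rewrite 1 [e]; ring
      exact le_of_mul_le_mul_left h6 hd
  · have hB := trap_B2 hz0 hz2.le hk0 hk2 haI haII (by
      rw [le_div_iff₀ (by norm_num)] at hv1
      linarith)
    have : (1 - (1 - x) ^ 2 * tkz z κ) ≤ 1 := by
      have := mul_nonneg (sq_nonneg (1 - x)) hR.le
      linarith
    calc 1.29 * (tM z κ * (1 - (1 - x) ^ 2 * tkz z κ) * tkz z κ)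
        ≤ 1.29 * (tM z κ * 1 * tkz z κ) := by gcongr
      _ ≤ _ := by linarith

/-- Nondegenerate channels. -/
structure Good (W : TECQuint) : Prop where
  p : 0 < W.p
  q : 0 ≤ W.q
  r : 0 ≤ W.r
  s : 0 ≤ W.s
  t : 0 < W.t
  e : 0 < W.q + W.r + W.s
  sum : W.p + W.q + W.r + W.s + W.t = 1

/-- Exchange of `p` and `t`. -/
def dual (W : TECQuint) : TECQuint := ⟨W.t, W.q, W.r, W.s, W.p⟩

theorem Good.dual {W : TECQuint} (h : Good W) : Good (dual W) :=
  ⟨h.t, h.q, h.r, h.s, h.p, h.e, by have := h.sum; simp only [_root_.dual]; linarith⟩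

theorem dual_dual (W : TECQuint) : dual (dual W) = W := rfl

theorem par_eq (W : TECQuint) : par W = dual (ser (dual W)) := by
  simp only [par, ser, dual, TECQuint.mk.injEq, and_true]
  ring

theorem Good.ser {W : TECQuint} (h : Good W) : Good (ser W) := by
  obtain ⟨p, q, r, s, t⟩ := W
  obtain ⟨hp, hq, hr, hs, ht, he, hsum⟩ := h
  simp only at *
  refine ⟨?_, ?_, ?_, ?_, ?_, ?_, ?_⟩ <;> simp only [TECQuint.ser]
  · positivity
  · positivity
  · positivity
  · positivity
  · have e : 1 = (p + q + r + s + t) ^ 2 := by rw [hsum]; norm_num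
    rw [e]
    have : 0 < t ^ 2 + (q + r + s) ^ 2 - (q * r + r * s + s * q) + 2 * t * (p + q + r + s) := by
      have : 0 < t ^ 2 := by positivity
      have : 0 ≤ 2 * t * (p + q + r + s) := by positivity
      nlinarith [sq_nonneg q, sq_nonneg r, sq_nonneg s, mul_nonneg hq hr, mul_nonneg hr hs,
        mul_nonneg hs hq]
    nlinarith
  · have : 0 < p * (q + r + s) := by positivity
    have := mul_nonneg hq hr
    have := mul_nonneg hr hs
    have := mul_nonneg hs hq
    nlinarith
  · ring

theorem Good.par {W : TECQuint} (h : Good W) : Good (par W) := by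
  rw [par_eq]; exact h.dual.ser.dual

theorem entropy_dual {W : TECQuint} (h : Good W) : entropy (dual W) = 1 - entropy W := by
  have := h.sum
  simp only [entropy, dual]
  linarith

theorem Good.H_pos {W : TECQuint} (h : Good W) : 0 < entropy W := by
  have := h.e
  have := h.t
  simp only [entropy]
  linarith

theorem Good.H_lt {W : TECQuint} (h : Good W) : entropy W < 1 := by
  have := h.dual.H_pos
  rw [entropy_dual h] at this
  linarith

theorem H_par {W : TECQuint} :
    entropy (par W) = entropy W ^ 2 - (W.q ^ 2 + W.r ^ 2 + W.s ^ 2) / 4 := by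
  simp only [entropy, par]
  ring

theorem H_ser {W : TECQuint} (h : Good W) : entropy (ser W) = 2 * entropy W - entropy (par W) := by
  rw [H_par]
  have := h.sum
  obtain ⟨p, q, r, s, t⟩ := W
  simp only [entropy, ser] at *
  obtain rfl : p = 1 - q - r - s - t := by linarith
  ring

theorem schur {q r s : ℝ} (hq : 0 ≤ q) (hr : 0 ≤ r) (hs : 0 ≤ s) :
    0 ≤ q * (q - r) * (q - s) + r * (r - q) * (r - s) + s * (s - q) * (s - r) := by
  have key : ∀ a b c : ℝ, 0 ≤ a → 0 ≤ b → 0 ≤ c → a ≤ b → b ≤ c →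
      0 ≤ a * (a - b) * (a - c) + b * (b - a) * (b - c) + c * (c - a) * (c - b) := by
    intro a b c ha hb hc hab hbc
    have h1 : 0 ≤ a * ((b - a) * (c - a)) :=
      mul_nonneg ha (mul_nonneg (by linarith) (by linarith))
    have h2 : 0 ≤ (c - b) * (c * (c - a) - b * (b - a)) := by
      apply mul_nonneg (by linarith)
      have : b * (b - a) ≤ c * (c - a) :=
        mul_le_mul hbc (by linarith) (by linarith) hc
      linarith
    nlinarith
  rcases le_total q r with h1 | h1 <;> rcases le_total r s with h2 | h2 <;>
    rcases le_total q s with h3 | h3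
  · exact (key q r s hq hr hs h1 h2).trans (le_of_eq (by ring))
  · exact (key q r s hq hr hs h1 h2).trans (le_of_eq (by ring))
  · exact (key q s r hq hs hr h3 h2).trans (le_of_eq (by ring))
  · exact (key s q r hs hq hr h3 h1).trans (le_of_eq (by ring))
  · exact (key r q s hr hq hs h1 h3).trans (le_of_eq (by ring))
  · exact (key r s q hr hs hq h2 h3).trans (le_of_eq (by ring))
  · exact (key s r q hs hr hq h2 h1).trans (le_of_eq (by ring))
  · exact (key s r q hs hr hq h2 h1).trans (le_of_eq (by ring))

/-- The corrected Quetelet index. -/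
def XX (W : TECQuint) : ℝ :=
  (edgeMass W - inertia W / (10 * edgeMass W)) / (entropy W * (1 - entropy W))

theorem XX_dual {W : TECQuint} (h : Good W) : XX (dual W) = XX W := by
  unfold XX
  rw [entropy_dual h]
  have h1 : edgeMass (dual W) = edgeMass W := rfl
  have h2 : inertia (dual W) = inertia W := rfl
  rw [h1, h2]
  congr 1
  ring

theorem Good.E_pos {W : TECQuint} (h : Good W) : 0 < edgeMass W := h.e

theorem Good.A_le {W : TECQuint} (h : Good W) : inertia W ≤ 2 * edgeMass W ^ 2 := by
  have h1 := mul_nonneg h.q h.r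
  have h2 := mul_nonneg h.r h.s
  have h3 := mul_nonneg h.s h.q
  simp only [inertia, edgeMass]
  nlinarith

theorem A_nonneg (W : TECQuint) : 0 ≤ inertia W := by
  simp only [inertia]; positivity

theorem Good.F_pos {W : TECQuint} (h : Good W) :
    0 < edgeMass W - inertia W / (10 * edgeMass W) := by
  have h1 := h.A_le
  have h2 := h.E_pos
  have : inertia W / (10 * edgeMass W) ≤ edgeMass W / 5 := by
    rw [div_le_iff₀ (by positivity)]
    linarith
  linarith

theorem Good.XX_pos {W : TECQuint} (h : Good W) : 0 < XX W :=
  div_pos h.F_pos (mul_pos h.H_pos (by have := h.H_lt; linarith))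

theorem A_ser_le1 {W : TECQuint} (h : Good W) : inertia (ser W) ≤
    inertia W * ((1 - entropy W) ^ 2 - edgeMass W ^ 2 / 36 + inertia W / 18) := by
  have hy : 1 - entropy W = W.p + (W.q + W.r + W.s) / 2 := by
    have := h.sum
    simp only [entropy]
    linarith
  rw [hy]
  obtain ⟨p, q, r, s, t⟩ := W
  obtain ⟨hp, hq, hr, hs, ht, he, hsum⟩ := h
  simp only [inertia, ser, edgeMass] at *
  have := mul_nonneg (by positivity : 0 ≤ 2 * p + 2 / 3 * (q + r + s)) (schur hq hr hs)
  rw [← sub_nonneg]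
  refine this.trans (le_of_eq ?_)
  ring

theorem A_ser_le2 {W : TECQuint} (h : Good W) : inertia (ser W) ≤
    W.p ^ 2 * inertia W + 2 * W.p * (edgeMass W * ((2 * edgeMass W ^ 2 - inertia W) / 6)) +
      2 * ((2 * edgeMass W ^ 2 - inertia W) / 6) ^ 2 := by
  obtain ⟨p, q, r, s, t⟩ := W
  obtain ⟨hp, hq, hr, hs, ht, he, hsum⟩ := h
  simp only [inertia, ser, edgeMass] at *
  have : 0 ≤ (18 * p + 6 * (q + r + s)) * (q * r * s) := by positivity
  rw [← sub_nonneg]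
  refine this.trans (le_of_eq ?_)
  ring

/-- Everything about the serial child in reduced coordinates. -/
theorem ser_coords {W : TECQuint} (h : Good W) : ∃ z κ a : ℝ, 0 < z ∧ z < 2 ∧ 0 ≤ κ ∧ κ ≤ 2 ∧
    a ≤ trapI z κ ∧ a ≤ trapII z κ ∧ XX W = z * (1 - κ / 10) / entropy W ∧
    XX (ser W) = (tM z κ ^ 2 - a / 10) * z /
      (tM z κ * (1 - (1 - entropy W) ^ 2 * tkz z κ) * tkz z κ) := by
  have hE := h.E_pos
  have hx := h.H_pos
  have hx1 := h.H_lt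
  have hA := h.A_le
  have hA0 := A_nonneg W
  have hA1 := A_ser_le1 h
  have hA2 := A_ser_le2 h
  have hp : W.p = (1 - entropy W) - edgeMass W / 2 := by
    have := h.sum
    simp only [entropy, edgeMass]
    linarith
  have hp0 := h.p
  have hEs : edgeMass (ser W) = 2 * (1 - entropy W) * edgeMass W - edgeMass W ^ 2 * (2 / 3)
      - inertia W / 6 := by
    have := h.sum
    obtain ⟨p, q, r, s, t⟩ := W
    simp only [entropy, edgeMass, ser, inertia] at *
    obtain rfl : p = 1 - q - r - s - t := by linarith
    ring
  have hHs : 1 - entropy (ser W) = (1 - entropy W) ^ 2 - (edgeMass W ^ 2 + inertia W) / 12 := by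
    rw [H_ser h, H_par]
    simp only [edgeMass, inertia]
    ring
  have hHs' : entropy (ser W) = 1 - ((1 - entropy W) ^ 2 - (edgeMass W ^ 2 + inertia W) / 12) := by
    rw [← hHs]; ring
  rw [hp] at hA2 hp0
  set x := entropy W with hxd
  set y := 1 - x with hyd
  set E := edgeMass W with hEd
  set A := inertia W with hAd
  have hy : 0 < y := by linarith
  have hz0 : 0 < E / y := by positivity
  have hz2 : E / y < 2 := by rw [div_lt_iff₀ hy]; linarith
  have hk0 : 0 ≤ A / E ^ 2 := by positivity
  have hk2 : A / E ^ 2 ≤ 2 := by rw [div_le_iff₀ (by positivity)]; exact hA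
  obtain ⟨hM, hR, -⟩ := trap_pos hz0 hz2 hk0 hk2
  refine ⟨E / y, A / E ^ 2, inertia (ser W) / (E ^ 2 * y ^ 2), hz0, hz2, hk0, hk2, ?_, ?_, ?_, ?_⟩
  · rw [div_le_iff₀ (by positivity)]
    refine hA1.trans (le_of_eq ?_)
    unfold trapI
    field_simp
    ring
  · rw [div_le_iff₀ (by positivity)]
    refine hA2.trans (le_of_eq ?_)
    unfold trapII
    field_simp
    ring
  · unfold XX
    rw [← hxd, ← hyd, ← hEd, ← hAd]
    field_simp
  · unfold XX
    have e1 : edgeMass (ser W) = E * y * tM (E / y) (A / E ^ 2) := by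
      rw [hEs]; unfold tM; field_simp; ring
    have e2 : 1 - entropy (ser W) = y ^ 2 * tkz (E / y) (A / E ^ 2) := by
      rw [hHs]; unfold tkz; field_simp
    have e3 : entropy (ser W) = 1 - y ^ 2 * tkz (E / y) (A / E ^ 2) := by rw [← e2]; ring
    have hHp := h.ser.H_pos
    rw [e2, e3, e1]
    rw [e3] at hHp
    generalize tM (E / y) (A / E ^ 2) = M at *
    generalize tkz (E / y) (A / E ^ 2) = R at *
    have hD := hHp.ne'
    generalize 1 - y ^ 2 * R = D at *
    field_simp

theorem trap_ser {W : TECQuint} (h : Good W) : min (XX W) 1.29 ≤ XX (ser W) := by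
  obtain ⟨z, κ, a, hz0, hz2, hk0, hk2, haI, haII, e1, e2⟩ := ser_coords h
  have hx := h.H_pos
  have hx1 := h.H_lt
  obtain ⟨hM, hR, hR1⟩ := trap_pos hz0 hz2 hk0 hk2
  have hD : 0 < 1 - (1 - entropy W) ^ 2 * tkz z κ := by
    have h1 : (1 - entropy W) ^ 2 < 1 := by nlinarith
    have : (1 - entropy W) ^ 2 * tkz z κ ≤ (1 - entropy W) ^ 2 * 1 := by gcongr
    linarith
  have hden : 0 < tM z κ * (1 - (1 - entropy W) ^ 2 * tkz z κ) * tkz z κ := by positivity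
  rw [e2]
  rcases le_total (z * (1 - κ / 10) / 1.29) (entropy W) with hc | hc
  · refine (min_le_left _ _).trans ?_
    have hv0 : 0 < z * (1 - κ / 10) / 1.29 := by
      have : 0 < 1 - κ / 10 := by linarith
      positivity
    have := trap_core1 (g := 1) hz0 hz2 hk0 hk2 haI haII hx hx1 hc (by
      have := tphi_diff (z := z) hk0 hv0 hc hx1.le
      linarith)
    rw [e1, div_le_div_iff₀ hx hden]
    have := mul_le_mul_of_nonneg_left this hz0.le
    refine le_trans (le_of_eq ?_) (this.trans (le_of_eq ?_)) <;> ring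
  · refine (min_le_right _ _).trans ?_
    rw [le_div_iff₀ hden]
    exact trap_core2 hz0 hz2 hk0 hk2 haI haII hx hx1 hc

theorem grow_ser {W : TECQuint} (h : Good W) (hX : XX W ≤ 1.285) (hH : 1 / 2 ≤ entropy W) :
    1.0009 * XX W ≤ XX (ser W) := by
  obtain ⟨z, κ, a, hz0, hz2, hk0, hk2, haI, haII, e1, e2⟩ := ser_coords h
  have hx := h.H_pos
  have hx1 := h.H_lt
  obtain ⟨hM, hR, hR1⟩ := trap_pos hz0 hz2 hk0 hk2
  have hD : 0 < 1 - (1 - entropy W) ^ 2 * tkz z κ := by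
    have h1 : (1 - entropy W) ^ 2 < 1 := by nlinarith
    have : (1 - entropy W) ^ 2 * tkz z κ ≤ (1 - entropy W) ^ 2 * 1 := by gcongr
    linarith
  have hden : 0 < tM z κ * (1 - (1 - entropy W) ^ 2 * tkz z κ) * tkz z κ := by positivity
  rw [e2]
  rw [e1, div_le_iff₀ hx] at hX
  have hv : z * (1 - κ / 10) / 1.29 ≤ 1.285 / 1.29 * entropy W := by
    rw [div_le_iff₀ (by norm_num)]
    norm_num at hX ⊢
    linarith
  have hc : z * (1 - κ / 10) / 1.29 ≤ entropy W := by
    norm_num at hv ⊢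
    linarith
  have hv0 : 0 < z * (1 - κ / 10) / 1.29 := by
    have : 0 < 1 - κ / 10 := by linarith
    positivity
  have := trap_core1 (g := 1.0009) hz0 hz2 hk0 hk2 haI haII hx hx1 hc (by
    have h1 := tphi_diff (z := z) hk0 hv0 hc hx1.le
    have h2 := tphi_le hz0 hz2 hk0 hk2 hH
    norm_num at *
    linarith)
  rw [e1, ← mul_div_assoc, div_le_div_iff₀ hx hden]
  have := mul_le_mul_of_nonneg_left this hz0.le
  refine le_trans (le_of_eq ?_) (this.trans (le_of_eq ?_)) <;> ring

theorem trap_par {W : TECQuint} (h : Good W) : min (XX W) 1.29 ≤ XX (par W) := by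
  rw [par_eq, XX_dual h.dual.ser, ← XX_dual h]
  exact trap_ser h.dual

theorem grow_par {W : TECQuint} (h : Good W) (hX : XX W ≤ 1.285) (hH : entropy W ≤ 1 / 2) :
    1.0009 * XX W ≤ XX (par W) := by
  rw [par_eq, XX_dual h.dual.ser, ← XX_dual h]
  rw [← XX_dual h] at hX
  exact grow_ser h.dual hX (by rw [entropy_dual h]; linarith)

/-- The trap factor. -/
def mm (W : TECQuint) : ℝ := max 1 (1.29 / XX W)

/-- The potential. -/
def psi (K : ℕ) (W : TECQuint) : ℝ := hh (entropy W) * mm W ^ K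

theorem one_le_mm (W : TECQuint) : 1 ≤ mm W := le_max_left _ _

theorem mm_le_of {W V : TECQuint} (hW : Good W) (h : min (XX W) 1.29 ≤ XX V) : mm V ≤ mm W := by
  refine max_le (one_le_mm W) ?_
  rcases le_total (XX W) 1.29 with h1 | h1
  · rw [min_eq_left h1] at h
    have := hW.XX_pos
    refine le_trans ?_ (le_max_right _ _)
    gcongr
  · rw [min_eq_right h1] at h
    refine le_trans ?_ (one_le_mm W)
    rw [div_le_one (by linarith)]
    exact h

theorem mm_le_of_grow {W V : TECQuint} (hW : Good W) (hX : XX W ≤ 1.285)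
    (h : 1.0009 * XX W ≤ XX V) : mm V ≤ 1 / 1.0009 * mm W := by
  have h0 := hW.XX_pos
  have h1 : 1.29 / XX W ≤ mm W := le_max_right _ _
  refine max_le ?_ ?_
  · have : 1.29 / 1.285 ≤ 1.29 / XX W := by gcongr
    norm_num at *
    linarith
  · have : 1.29 / XX V ≤ 1.29 / (1.0009 * XX W) := by gcongr
    refine this.trans ?_
    have e : 1.29 / (1.0009 * XX W) = 1 / 1.0009 * (1.29 / XX W) := by field_simp
    rw [e]
    gcongr

theorem psi_dual (K : ℕ) {W : TECQuint} (h : Good W) : psi K (dual W) = psi K W := by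
  unfold psi mm
  rw [XX_dual h, entropy_dual h, hh_symm]

theorem hh_le_psi (K : ℕ) {W : TECQuint} (h : Good W) : hh (entropy W) ≤ psi K W := by
  have h1 := hh_pos h.H_pos h.H_lt
  have h2 := one_le_pow₀ (one_le_mm W) (n := K)
  exact le_mul_of_one_le_right h1.le h2

theorem H_par_le {W : TECQuint} (h : Good W) (hX : 1.285 ≤ XX W) :
    entropy (par W) ≤ entropy W ^ 2 - 11 / 80 * (entropy W * (1 - entropy W)) ^ 2 := by
  have hu : 0 < entropy W * (1 - entropy W) := mul_pos h.H_pos (by have := h.H_lt; linarith)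
  have e : (W.q ^ 2 + W.r ^ 2 + W.s ^ 2) / 4 = (edgeMass W ^ 2 + inertia W) / 12 := by
    simp only [edgeMass, inertia]; ring
  rw [H_par, e]
  unfold XX at hX
  rw [le_div_iff₀ hu] at hX
  have hE := h.E_pos
  have hA := A_nonneg W
  have h1 : 0 ≤ inertia W / (10 * edgeMass W) := by positivity
  have h2 : 1.285 * (entropy W * (1 - entropy W)) ≤ edgeMass W := by linarith
  have h3 : (1.285 * (entropy W * (1 - entropy W))) ^ 2 ≤ edgeMass W ^ 2 := by gcongr
  generalize entropy W * (1 - entropy W) = u at *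
  have := sq_nonneg u
  norm_num [mul_pow] at h3
  linarith

theorem psi_half {K : ℕ} (hK : (1 / 1.0009 : ℝ) ^ K ≤ 0.01) {W : TECQuint} (h : Good W)
    (hx2 : entropy W ≤ 1 / 2) : psi K (ser W) + psi K (par W) ≤ 1.636 * psi K W := by
  have hx := h.H_pos
  have hm1 := one_le_mm W
  have hms := mm_le_of h (trap_ser h)
  have hmp := mm_le_of h (trap_par h)
  have hs0 := h.ser.H_pos
  have hs1 := h.ser.H_lt
  have hp0 := h.par.H_pos
  have hp1 := h.par.H_lt
  have hhs := hh_pos hs0 hs1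
  have hhp := hh_pos hp0 hp1
  have hhx := hh_pos hx h.H_lt
  have hmK : 0 < mm W ^ K := by positivity
  have h1s := one_le_mm (ser W)
  have h1p := one_le_mm (par W)
  have hmsK : mm (ser W) ^ K ≤ mm W ^ K := by gcongr
  have hmpK : mm (par W) ^ K ≤ mm W ^ K := by gcongr
  have hHs := H_ser h
  have hpsq : entropy (par W) ≤ entropy W ^ 2 := by
    rw [H_par]
    have : 0 ≤ (W.q ^ 2 + W.r ^ 2 + W.s ^ 2) / 4 := by positivity
    linarith
  have hpx : entropy (par W) ≤ entropy W := by nlinarith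
  unfold psi
  rcases le_total 1.285 (XX W) with hX | hX
  · have h1 := hh_contract hx hx2 hp0 (H_par_le h hX) (by rw [← hHs]; exact hs1)
    rw [← hHs] at h1
    calc hh (entropy (ser W)) * mm (ser W) ^ K + hh (entropy (par W)) * mm (par W) ^ K
        ≤ hh (entropy (ser W)) * mm W ^ K + hh (entropy (par W)) * mm W ^ K := by gcongr
      _ = (hh (entropy (ser W)) + hh (entropy (par W))) * mm W ^ K := by ring
      _ ≤ (1.636 * hh (entropy W)) * mm W ^ K := by gcongr
      _ = _ := by ring
  · have h1 := hh_double hx hx2 hs0 hs1 (by rw [hHs]; linarith)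
    have h2 := hh_mono hp0 hpx hx2
    have h3 := mm_le_of_grow h hX (grow_par h hX hx2)
    have h4 : mm (par W) ^ K ≤ 0.01 * mm W ^ K := by
      calc mm (par W) ^ K ≤ (1 / 1.0009 * mm W) ^ K := by gcongr
        _ = (1 / 1.0009) ^ K * mm W ^ K := by rw [mul_pow]
        _ ≤ _ := by gcongr
    calc hh (entropy (ser W)) * mm (ser W) ^ K + hh (entropy (par W)) * mm (par W) ^ K
        ≤ (1.62 * hh (entropy W)) * mm W ^ K + hh (entropy W) * (0.01 * mm W ^ K) := by gcongr
      _ = 1.63 * (hh (entropy W) * mm W ^ K) := by ring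
      _ ≤ _ := by gcongr; norm_num

theorem psi_step {K : ℕ} (hK : (1 / 1.0009 : ℝ) ^ K ≤ 0.01) {W : TECQuint} (h : Good W) :
    psi K (ser W) + psi K (par W) ≤ 1.636 * psi K W := by
  rcases le_total (entropy W) (1 / 2) with hx | hx
  · exact psi_half hK h hx
  · have h1 := psi_half hK h.dual (by rw [entropy_dual h]; linarith)
    have e1 : psi K (par W) = psi K (ser (dual W)) := by
      rw [par_eq, psi_dual K h.dual.ser]
    have e2 : psi K (par (dual W)) = psi K (ser W) := by
      rw [par_eq, psi_dual K (by rw [dual_dual]; exact h.ser), dual_dual]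
    rw [psi_dual K h, e2] at h1
    rw [e1]
    linarith

theorem Good.child {W : TECQuint} (h : Good W) (b : Bool) : Good (child W b) := by
  cases b
  · exact h.par
  · exact h.ser

theorem sum_succ (n : ℕ) (W : TECQuint) (f : TECQuint → ℝ) :
    ∑ c : Fin (n + 1) → Bool, f (descend W c) =
      (∑ c : Fin n → Bool, f (descend (ser W) c)) + ∑ c : Fin n → Bool, f (descend (par W) c) := by
  rw [← (Fin.consEquiv (fun _ : Fin (n + 1) => Bool)).sum_comp, Fintype.sum_prod_type,
    Fintype.sum_bool]
  rfl

theorem Good.descend {n : ℕ} : ∀ {W : TECQuint}, Good W → ∀ c : Fin n → Bool,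
    Good (descend W c) := by
  induction n with
  | zero => intro W h c; exact h
  | succ n ih => intro W h c; exact ih (h.child (c 0)) _

theorem sum_H (n : ℕ) : ∀ {W : TECQuint}, Good W →
    ∑ c : Fin n → Bool, (1 - entropy (descend W c)) = 2 ^ n * (1 - entropy W) := by
  induction n with
  | zero => intro W h; simp [TECQuint.descend]
  | succ n ih =>
    intro W h
    rw [sum_succ n W (fun V => 1 - entropy V), ih h.ser, ih h.par, H_ser h, pow_succ]
    ring

theorem sum_psi {K : ℕ} (hK : (1 / 1.0009 : ℝ) ^ K ≤ 0.01) (n : ℕ) : ∀ {W : TECQuint}, Good W →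
    ∑ c : Fin n → Bool, psi K (descend W c) ≤ 1.636 ^ n * psi K W := by
  induction n with
  | zero => intro W h; simp [TECQuint.descend]
  | succ n ih =>
    intro W h
    rw [sum_succ n W (psi K), pow_succ]
    have h1 := ih h.ser
    have h2 := ih h.par
    have h3 := mul_le_mul_of_nonneg_left (psi_step hK h) (by positivity : (0 : ℝ) ≤ 1.636 ^ n)
    linarith

theorem pointwise {x T : ℝ} (hx : 0 < x) (hx1 : x < 1) (hT : 1 ≤ T) :
    1 - x ≤ (if x < Real.exp (-T) then 1 else 0) + T * hh x := by
  have hh0 := hh_pos hx hx1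
  have hlog2 : (1 / 2 : ℝ) < Real.log 2 := by have := Real.log_two_gt_d9; linarith
  split_ifs with h
  · have : 0 < T * hh x := by positivity
    linarith
  · rw [zero_add]
    rcases le_total x (1 / 2) with h2 | h2
    · have h3 := hh_lower hx h2
      have hL1 : 1 ≤ Lb x := by simpa using Lb_ge hx 1 (by simpa using h2)
      have hL : Lb x ≤ 2 * T := by
        have h4 : -T ≤ Real.log x := (Real.le_log_iff_exp_le hx).2 (not_lt.1 h)
        unfold Lb Real.logb
        rw [← neg_div, div_le_iff₀ (by linarith)]
        nlinarith
      have h5 : 1 ≤ T * (238016112 / (24 + Lb x)) := by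
        rw [← mul_div_assoc, one_le_div (by linarith)]
        linarith
      have h6 : T * (238016112 / (24 + Lb x)) ≤ T * hh x := by gcongr
      linarith
    · have hy : 0 < 1 - x := by linarith
      have hy2 : 1 - x ≤ 1 / 2 := by linarith
      have h3 := hh_lower hy hy2
      rw [hh_symm] at h3
      have hL1 : 1 ≤ Lb (1 - x) := by simpa using Lb_ge hy 1 (by simpa using hy2)
      have hL : (1 - x) * Lb (1 - x) ≤ 2 := by
        have h4 : Real.log (1 - x)⁻¹ ≤ (1 - x)⁻¹ - 1 := Real.log_le_sub_one_of_pos (by positivity)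
        rw [Real.log_inv] at h4
        have h5 : Lb (1 - x) ≤ 2 * (1 - x)⁻¹ := by
          unfold Lb Real.logb
          rw [← neg_div, div_le_iff₀ (by linarith)]
          have : 0 < (1 - x)⁻¹ := by positivity
          nlinarith
        have h6 := mul_le_mul_of_nonneg_left h5 hy.le
        have h7 : (1 - x) * (2 * (1 - x)⁻¹) = 2 := by field_simp
        linarith
      have h5 : 1 - x ≤ 238016112 / (24 + Lb (1 - x)) := by
        rw [le_div_iff₀ (by linarith)]
        linarith
      have h6 : 1 * hh x ≤ T * hh x := by gcongr
      linarith

theorem cube_bound {ε s : ℝ} (hε : 0 < ε) (hs : 0 ≤ s) : s ≤ ε * s ^ 3 + 1 / Real.sqrt ε := by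
  have h0 : 0 < Real.sqrt ε := Real.sqrt_pos.2 hε
  rcases le_total s (1 / Real.sqrt ε) with h | h
  · have : 0 ≤ ε * s ^ 3 := by positivity
    linarith
  · have h1 : 1 ≤ Real.sqrt ε * s := by
      rw [div_le_iff₀ h0] at h
      linarith
    have h2 : 1 ≤ ε * s ^ 2 := by
      have := one_le_pow₀ h1 (n := 2)
      rwa [mul_pow, Real.sq_sqrt hε.le] at this
    have h3 := mul_le_mul_of_nonneg_right h2 hs
    have : 0 < 1 / Real.sqrt ε := by positivity
    nlinarith

set_option exponentiation.threshold 10000 in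
theorem rate_pos : 0 < -Real.log 0.818 - Real.log 2 / 3.451 := by
  have h : (818 : ℝ) ^ 3451 * 2 ^ 1000 < 1000 ^ 3451 := by norm_num
  have h2 := Real.log_lt_log (by positivity) h
  rw [Real.log_mul (by positivity) (by positivity), Real.log_pow, Real.log_pow, Real.log_pow] at h2
  have e : (0.818 : ℝ) = 818 / 1000 := by norm_num
  rw [e, Real.log_div (by norm_num) (by norm_num)]
  have e2 : Real.log 2 / 3.451 = Real.log 2 * (1000 / 3451) := by ring
  rw [e2]
  push_cast at h2
  linarith

theorem rate_bound (n : ℕ) : Real.exp ((n : ℝ) ^ ((1 : ℝ) / 3)) * 0.818 ^ n ≤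
    Real.exp (1 / Real.sqrt (-Real.log 0.818 - Real.log 2 / 3.451)) *
      (2 : ℝ) ^ (-(n : ℝ) / 3.451) := by
  have h := rate_pos
  set ε := -Real.log 0.818 - Real.log 2 / 3.451 with hε
  have hs : 0 ≤ (n : ℝ) ^ ((1 : ℝ) / 3) := by positivity
  have h1 := cube_bound h hs
  have e3 : ((n : ℝ) ^ ((1 : ℝ) / 3)) ^ 3 = n := by
    rw [← Real.rpow_natCast, ← Real.rpow_mul (by positivity)]
    norm_num
  rw [e3] at h1
  have e1 : (0.818 : ℝ) ^ n = Real.exp (n * Real.log 0.818) := by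
    rw [mul_comm, Real.exp_mul, Real.exp_log (by norm_num), Real.rpow_natCast]
  rw [e1, Real.rpow_def_of_pos (by norm_num : (0 : ℝ) < 2), ← Real.exp_add, ← Real.exp_add]
  apply Real.exp_le_exp.2
  have e2 : Real.log 2 * (-(n : ℝ) / 3.451) = - n * (Real.log 2 / 3.451) := by ring
  rw [e2]
  have e4 : ε * (n : ℝ) = (-Real.log 0.818 - Real.log 2 / 3.451) * n := by rw [hε]
  rw [e4] at h1
  linarith

theorem good_of_hyp (W : TECQuint)
    (hW : (∃ ε : ℝ, 0 < ε ∧ ε < 1 ∧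
            W = ⟨(1 - ε) ^ 2, (1 - ε) * ε, 0, ε * (1 - ε), ε ^ 2⟩) ∨
          (W.IsTEC ∧ 0 < W.p ∧ 0 < W.q ∧ 0 < W.r ∧ 0 < W.s ∧ 0 < W.t)) : Good W := by
  rcases hW with ⟨ε, h0, h1, rfl⟩ | ⟨h, hp, hq, hr, hs, ht⟩
  · have h2 : 0 < 1 - ε := by linarith
    refine ⟨?_, ?_, ?_, ?_, ?_, ?_, ?_⟩ <;> simp only
    · positivity
    · positivity
    · exact le_rfl
    · positivity
    · positivity
    · positivity
    · ring
  · exact ⟨hp, hq.le, hr.le, hs.le, ht, by positivity, h.2.2.2.2.2⟩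

theorem main_scaling_exponent (W : TECQuint)
    (hW : (∃ ε : ℝ, 0 < ε ∧ ε < 1 ∧
            W = ⟨(1 - ε) ^ 2, (1 - ε) * ε, 0, ε * (1 - ε), ε ^ 2⟩) ∨
          (W.IsTEC ∧ 0 < W.p ∧ 0 < W.q ∧ 0 < W.r ∧ 0 < W.s ∧ 0 < W.t)) :
    ∃ C : ℝ, 0 < C ∧ ∀ n : ℕ, 1 ≤ n →
      (2 : ℝ) ^ n * (1 - entropy W - C * (2 : ℝ) ^ (-(n : ℝ) / 3.451)) <
        (Nat.card {c : Fin n → Bool //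
          entropy (descend W c) < Real.exp (-Real.exp ((n : ℝ) ^ ((1 : ℝ) / 3)))} : ℝ) := by
  have hG := good_of_hyp W hW
  obtain ⟨K, hK⟩ := exists_pow_lt_of_lt_one (by norm_num : (0 : ℝ) < 0.01)
    (by norm_num : (1 / 1.0009 : ℝ) < 1)
  have hK := hK.le
  have hpsi : 0 < psi K W := lt_of_lt_of_le (hh_pos hG.H_pos hG.H_lt) (hh_le_psi K hG)
  refine ⟨Real.exp (1 / Real.sqrt (-Real.log 0.818 - Real.log 2 / 3.451)) * psi K W + 1,
    by positivity, ?_⟩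
  intro n _
  set T := Real.exp ((n : ℝ) ^ ((1 : ℝ) / 3)) with hT
  have hT1 : 1 ≤ T := Real.one_le_exp (by positivity)
  have h1 : ∑ c : Fin n → Bool, (1 - entropy (descend W c)) ≤
      ∑ c : Fin n → Bool, ((if entropy (descend W c) < Real.exp (-T) then (1 : ℝ) else 0)
        + T * psi K (descend W c)) := by
    refine Finset.sum_le_sum fun c _ => ?_
    have hc := hG.descend c
    have h2 := pointwise hc.H_pos hc.H_lt hT1
    have h3 : T * hh (entropy (descend W c)) ≤ T * psi K (descend W c) := by
      have := hh_le_psi K hc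
      gcongr
    linarith
  rw [sum_H n hG, Finset.sum_add_distrib, ← Finset.mul_sum] at h1
  have hcard : (Nat.card {c : Fin n → Bool // entropy (descend W c) < Real.exp (-T)} : ℝ) =
      ∑ c : Fin n → Bool, (if entropy (descend W c) < Real.exp (-T) then (1 : ℝ) else 0) := by
    classical
    rw [Nat.card_eq_fintype_card, Fintype.card_subtype, Finset.sum_boole]
  rw [hcard]
  have h2 := mul_le_mul_of_nonneg_left (sum_psi hK n hG) (by positivity : 0 ≤ T)
  have h3 := mul_le_mul_of_nonneg_left (rate_bound n)
    (by positivity : 0 ≤ (2 : ℝ) ^ n * psi K W)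
  rw [← hT] at h3
  have e : (1.636 : ℝ) ^ n = 2 ^ n * 0.818 ^ n := by rw [← mul_pow]; norm_num
  rw [e] at h2
  have h4 : (0 : ℝ) < 2 ^ n * (2 : ℝ) ^ (-(n : ℝ) / 3.451) := by positivity
  nlinarith
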